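/- arXiv:1103.0571 — 2 statements merged into one kernel-verified Lean document; each statement's English description precedes it below -/
import Mathlib

section
/- Suppose k ≥ 2 and set R = max{ ‖z − p − π(z)·v‖ : z ∈ {y_1,…,y_ℓ} ∪ {x_1,…,x_k} }. Let t₁, t₂ ∈ ℝ with t₂ = t₁ + 2·C·R + σ for some σ > 0. Suppose that no π(x_i) and no π(y_j) lies in the open interval (t₁, t₂), that some π(x_i) lies in the interval (t₁ − σ, t₁], and that some π(x_{i'}) lies in the interval [t₂, t₂ + σ). Then for every optimal assignment map S, every j ∈ {1,…,ℓ}, and each of the intervals I = (−∞, t₁] and I = [t₂, ∞): π(y_j) ∈ I if and only if π(x_{S(j)}) ∈ I. -/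
open scoped BigOperators RealInnerProductSpace

noncomputable section

attribute [local instance] Classical.propDecidable

/-- Points of the ambient Euclidean space `ℝ^m`. -/
abbrev Pt (m : ℕ) := EuclideanSpace ℝ (Fin m)

/-- A weighted directed graph in `ℝ^m`: a finite vertex set, a finite set of
directed edges (ordered pairs of points, viewed as directed line segments), and
a weight function. -/
structure WDG (m : ℕ) where
  V : Finset (Pt m)
  E : Finset (Pt m × Pt m)
  w : Pt m × Pt m → ℝ

namespace WDG

variable {m : ℕ}

/-- Edges join distinct vertices of the graph and carry positive weight. -/
def edgesOK (G : WDG m) : Prop :=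
  ∀ e ∈ G.E, e.1 ∈ G.V ∧ e.2 ∈ G.V ∧ e.1 ≠ e.2 ∧ 0 < G.w e

/-- The underlying undirected (simple) graph. -/
def undirected (G : WDG m) : SimpleGraph (Pt m) :=
  SimpleGraph.fromRel (fun u v => (u, v) ∈ G.E)

/-- The cost `M_α(G) = Σ_{e ∈ E(G)} w(e)^α · length(e)`. -/
def cost (α : ℝ) (G : WDG m) : ℝ :=
  ∑ e ∈ G.E, (G.w e) ^ α * dist e.1 e.2

/-- Total weight of edges starting at `v`. -/
def outflow (G : WDG m) (v : Pt m) : ℝ :=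
  ∑ e ∈ G.E.filter (fun e => e.1 = v), G.w e

/-- Total weight of edges ending at `v`. -/
def inflow (G : WDG m) (v : Pt m) : ℝ :=
  ∑ e ∈ G.E.filter (fun e => e.2 = v), G.w e

end WDG

/-- Atomic measures are represented as finitely supported functions `ℝ^m →₀ ℝ`
with nonnegative values; `AtomicOn X c` also requires the atoms to lie in `X`. -/
def AtomicOn {m : ℕ} (X : Set (Pt m)) (c : Pt m →₀ ℝ) : Prop :=
  (∀ z, 0 ≤ c z) ∧ ↑c.support ⊆ X

/-- The mass `m(c)` of an atomic measure. -/
def massOf {m : ℕ} (c : Pt m →₀ ℝ) : ℝ := c.sum fun _ t => t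

/-- `G` is a transport path from `a` to `b` inside `X`: its vertices lie in `X`
and contain the atoms of `a` and `b`, its underlying undirected graph has no
cycles, and the balance equation holds at every vertex. -/
def IsTransportPath {m : ℕ} (X : Set (Pt m)) (G : WDG m) (a b : Pt m →₀ ℝ) : Prop :=
  G.edgesOK ∧ ↑G.V ⊆ X ∧
  (∀ z ∈ a.support, z ∈ G.V) ∧ (∀ z ∈ b.support, z ∈ G.V) ∧
  G.undirected.IsAcyclic ∧
  ∀ v : Pt m, G.outflow v - G.inflow v = a v - b v

/-- `d_α(a,b)`: the minimal cost of a transport path from `a` to `b`. -/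
def dCost {m : ℕ} (X : Set (Pt m)) (α : ℝ) (a b : Pt m →₀ ℝ) : ℝ :=
  sInf (WDG.cost α '' {G : WDG m | IsTransportPath X G a b})

/-- An optimal transport path from `a` to `b`. -/
def IsOptimalTP {m : ℕ} (X : Set (Pt m)) (α : ℝ) (G : WDG m) (a b : Pt m →₀ ℝ) : Prop :=
  IsTransportPath X G a b ∧
    ∀ G' : WDG m, IsTransportPath X G' a b → WDG.cost α G ≤ WDG.cost α G'

/-- The atomic probability measure `b = Σ_j n_j δ_{y_j}` of households. -/
def bMeas {m ℓ : ℕ} (y : Fin ℓ → Pt m) (n : Fin ℓ → ℝ) : Pt m →₀ ℝ :=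
  ∑ j, Finsupp.single (y j) (n j)

/-- An allocation path from the factory locations `x` to the households `(y,n)`:
a transport path to `b` from some atomic probability measure supported on the
factory locations. -/
def IsAllocPath {m k ℓ : ℕ} (X : Set (Pt m)) (x : Fin k → Pt m)
    (y : Fin ℓ → Pt m) (n : Fin ℓ → ℝ) (G : WDG m) : Prop :=
  ∃ a : Pt m →₀ ℝ, (∀ z, 0 ≤ a z) ∧ ↑a.support ⊆ Set.range x ∧ massOf a = 1 ∧
    IsTransportPath X G a (bMeas y n)

/-- An optimal allocation path: it minimizes `M_α` over all allocation paths. -/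
def IsOptimalAllocPath {m k ℓ : ℕ} (X : Set (Pt m)) (α : ℝ) (x : Fin k → Pt m)
    (y : Fin ℓ → Pt m) (n : Fin ℓ → ℝ) (G : WDG m) : Prop :=
  IsAllocPath X x y n G ∧
    ∀ G' : WDG m, IsAllocPath X x y n G' → WDG.cost α G ≤ WDG.cost α G'

/-- For an assignment map `S`, the part `b_i = Σ_{j : S(j) = i} n_j δ_{y_j}`. -/
def bPart {m k ℓ : ℕ} (y : Fin ℓ → Pt m) (n : Fin ℓ → ℝ) (S : Fin ℓ → Fin k)
    (i : Fin k) : Pt m →₀ ℝ :=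
  ∑ j ∈ Finset.univ.filter (fun j => S j = i), Finsupp.single (y j) (n j)

/-- The mass `m(b_i) = Σ_{j : S(j) = i} n_j`. -/
def mB {k ℓ : ℕ} (n : Fin ℓ → ℝ) (S : Fin ℓ → Fin k) (i : Fin k) : ℝ :=
  ∑ j ∈ Finset.univ.filter (fun j => S j = i), n j

/-- `E_α(S) = Σ_i d_α(m(b_i) δ_{x_i}, b_i)`. -/
def Ealpha {m k ℓ : ℕ} (X : Set (Pt m)) (α : ℝ) (x : Fin k → Pt m)
    (y : Fin ℓ → Pt m) (n : Fin ℓ → ℝ) (S : Fin ℓ → Fin k) : ℝ :=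
  ∑ i, dCost X α (Finsupp.single (x i) (mB n S i)) (bPart y n S i)

/-- An optimal assignment map minimizes `E_α` over all assignment maps. -/
def IsOptimalAssign {m k ℓ : ℕ} (X : Set (Pt m)) (α : ℝ) (x : Fin k → Pt m)
    (y : Fin ℓ → Pt m) (n : Fin ℓ → ℝ) (S : Fin ℓ → Fin k) : Prop :=
  ∀ S' : Fin ℓ → Fin k, Ealpha X α x y n S ≤ Ealpha X α x y n S'

/-- `ρ_α(σ,ε)`: equals `(σ/ε)^α − (σ/ε − 1)^α` for `σ > ε` (and for `σ = ε` when
`α ∈ (0,1)`), and equals `1` when `σ = ε` (covering also the convention for `α = 0`). -/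
def rho (α σ ε : ℝ) : ℝ :=
  if σ = ε then 1 else (σ / ε) ^ α - (σ / ε - 1) ^ α


/-- `G` is the disjoint union of the subgraphs `Gi`: the `Gi` have pairwise
disjoint vertex sets, each is a subgraph of `G` (with matching weights), and
the edges of `G` are exactly the (disjoint) union of their edges. -/
def IsDisjointUnion {m k : ℕ} (G : WDG m) (Gi : Fin k → WDG m) : Prop :=
  (∀ i i' : Fin k, i ≠ i' → Disjoint (Gi i).V (Gi i').V) ∧
  (∀ i, (Gi i).V ⊆ G.V) ∧
  (∀ i, (Gi i).E ⊆ G.E) ∧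
  (∀ i, ∀ e ∈ (Gi i).E, (Gi i).w e = G.w e) ∧
  G.E = Finset.univ.biUnion (fun i => (Gi i).E)

/-- The projection coordinate `π(z) = ⟨z − p, v⟩` along the line through `p`
in direction `v`. -/
def proj {m : ℕ} (p v z : Pt m) : ℝ := ⟪z - p, v⟫

/-- The constant `C = √(m−1)/(2^{1−(m−1)(1−α)} − 1) + 1`. -/
def Cconst (m : ℕ) (α : ℝ) : ℝ :=
  Real.sqrt ((m : ℝ) - 1) / ((2 : ℝ) ^ (1 - ((m : ℝ) - 1) * (1 - α)) - 1) + 1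


/-- The cost of carrying mass `t` over unit length, with no cost for zero mass (also if `α = 0`). -/
def massCost (α t : ℝ) : ℝ := if t = 0 then 0 else t ^ α

lemma massCost_zero (α : ℝ) : massCost α 0 = 0 := by simp [massCost]

lemma massCost_of_pos (α : ℝ) {t : ℝ} (ht : 0 < t) : massCost α t = t ^ α := by
  simp [massCost, ht.ne']

lemma massCost_of_exponent_pos {α : ℝ} (hα : 0 < α) (t : ℝ) : massCost α t = t ^ α := by
  by_cases h : t = 0
  · simp [massCost, h, Real.zero_rpow hα.ne']
  · simp [massCost, h]

lemma massCost_nonneg (α : ℝ) {t : ℝ} (ht : 0 ≤ t) : 0 ≤ massCost α t := by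
  unfold massCost
  split_ifs
  · exact le_rfl
  · positivity

lemma massCost_mono {α : ℝ} (hα : 0 ≤ α) {s t : ℝ} (hs : 0 ≤ s) (hst : s ≤ t) :
    massCost α s ≤ massCost α t := by
  rcases hs.eq_or_lt with rfl | hs'
  · rw [massCost_zero]
    exact massCost_nonneg α hst
  · rw [massCost_of_pos α hs', massCost_of_pos α (hs'.trans_le hst)]
    gcongr

lemma massCost_add_le {α : ℝ} (hα : 0 ≤ α) (hα1 : α ≤ 1) {s t : ℝ} (hs : 0 ≤ s) (ht : 0 ≤ t) :
    massCost α (s + t) ≤ massCost α s + massCost α t := by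
  rcases hs.eq_or_lt with rfl | hs'
  · simp [massCost_zero]
  rcases ht.eq_or_lt with rfl | ht'
  · simp [massCost_zero]
  rw [massCost_of_pos α hs', massCost_of_pos α ht', massCost_of_pos α (by linarith)]
  exact Real.rpow_add_le_add_rpow hs ht hα hα1

lemma concaveOn_massCost {α : ℝ} (hα : 0 ≤ α) (hα1 : α ≤ 1) :
    ConcaveOn ℝ (Set.Ici 0) (massCost α) := by
  rcases hα.eq_or_lt with rfl | hα'
  · refine ⟨convex_Ici 0, ?_⟩
    intro s hs t ht a b ha hb hab
    have hs : 0 ≤ s := hs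
    have ht : 0 ≤ t := ht
    simp only [smul_eq_mul, massCost, Real.rpow_zero]
    by_cases h : a * s + b * t = 0
    · have h1 : a * s = 0 := by nlinarith [mul_nonneg ha hs, mul_nonneg hb ht]
      have h2 : b * t = 0 := by nlinarith [mul_nonneg ha hs, mul_nonneg hb ht]
      rcases mul_eq_zero.1 h1 with h1 | h1 <;> rcases mul_eq_zero.1 h2 with h2 | h2 <;>
        simp_all
    · rw [if_neg h]
      split_ifs <;> linarith
  · have h : massCost α = fun t => t ^ α := funext (massCost_of_exponent_pos hα')
    rw [h]
    exact Real.concaveOn_rpow hα hα1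

lemma mul_rpow_sub_one_le_massCost {α : ℝ} (hα1 : α ≤ 1) {t M : ℝ} (ht : 0 ≤ t)
    (htM : t ≤ M) : t * M ^ (α - 1) ≤ massCost α t := by
  rcases ht.eq_or_lt with rfl | ht'
  · simp [massCost_zero]
  · rw [massCost_of_pos α ht']
    calc t * M ^ (α - 1) ≤ t * t ^ (α - 1) := by
          refine mul_le_mul_of_nonneg_left ?_ ht
          exact Real.rpow_le_rpow_of_nonpos ht' htM (by linarith)
      _ = t ^ α := by
          rw [Real.rpow_sub_one ht'.ne']
          field_simp

/-- A flow on the complete digraph on `ℝ^m`: a finitely supported weight on directed edges. -/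
abbrev WFlow (m : ℕ) := Pt m × Pt m →₀ ℝ

namespace WFlow

variable {m : ℕ}

/-- The divergence of a flow: outgoing minus incoming weight. -/
def div : WFlow m →ₗ[ℝ] (Pt m →₀ ℝ) :=
  Finsupp.lmapDomain ℝ ℝ Prod.fst - Finsupp.lmapDomain ℝ ℝ Prod.snd

lemma div_apply (f : WFlow m) :
    div f = f.mapDomain Prod.fst - f.mapDomain Prod.snd := rfl

lemma div_single (u v : Pt m) (t : ℝ) :
    div (Finsupp.single (u, v) t) = Finsupp.single u t - Finsupp.single v t := by
  simp [div_apply, Finsupp.mapDomain_single]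

/-- The image of a flow under a map of the vertices. -/
def push (F : Pt m → Pt m) (f : WFlow m) : WFlow m := f.mapDomain (Prod.map F F)

lemma div_push (F : Pt m → Pt m) (f : WFlow m) : div (push F f) = (div f).mapDomain F := by
  have h : (div f).mapDomain F = Finsupp.lmapDomain ℝ ℝ F (div f) := rfl
  rw [h, div_apply f, map_sub]
  simp only [Finsupp.lmapDomain_apply, push, div_apply, ← Finsupp.mapDomain_comp]
  rfl

/-- The cost of a flow. -/
def fcost (α : ℝ) (f : WFlow m) : ℝ := f.sum fun e t => massCost α t * dist e.1 e.2

lemma fcost_eq_sum (α : ℝ) {f : WFlow m} {T : Finset (Pt m × Pt m)} (hT : f.support ⊆ T) :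
    fcost α f = ∑ e ∈ T, massCost α (f e) * dist e.1 e.2 :=
  Finsupp.sum_of_support_subset f hT _ (by simp [massCost_zero])

lemma fcost_mono {α : ℝ} (hα : 0 ≤ α) {f g : WFlow m} (hf : 0 ≤ f) (hfg : f ≤ g) :
    fcost α f ≤ fcost α g := by
  rw [fcost_eq_sum α (Finset.subset_union_left (s₂ := g.support)),
    fcost_eq_sum α (Finset.subset_union_right (s₁ := f.support))]
  refine Finset.sum_le_sum fun e _ => ?_
  exact mul_le_mul_of_nonneg_right (massCost_mono hα (hf e) (hfg e)) dist_nonneg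

lemma fcost_add_le {α : ℝ} (hα : 0 ≤ α) (hα1 : α ≤ 1) {f g : WFlow m} (hf : 0 ≤ f) (hg : 0 ≤ g) :
    fcost α (f + g) ≤ fcost α f + fcost α g := by
  rw [fcost_eq_sum α (f := f) (Finset.subset_union_left (s₂ := g.support)),
    fcost_eq_sum α (f := g) (Finset.subset_union_right (s₁ := f.support)),
    fcost_eq_sum α (Finsupp.support_add (g₁ := f) (g₂ := g)), ← Finset.sum_add_distrib]
  refine Finset.sum_le_sum fun e _ => ?_
  rw [← add_mul]
  exact mul_le_mul_of_nonneg_right (massCost_add_le hα hα1 (hf e) (hg e)) dist_nonneg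

lemma fcost_single (α : ℝ) (u v : Pt m) (t : ℝ) :
    fcost α (Finsupp.single (u, v) t) = massCost α t * dist u v := by
  simp [fcost, Finsupp.sum_single_index, massCost_zero]

lemma push_nonneg (F : Pt m → Pt m) {f : WFlow m} (hf : 0 ≤ f) : 0 ≤ push F f := by
  unfold push Finsupp.mapDomain Finsupp.sum
  refine Finset.sum_nonneg fun e _ => ?_
  exact Finsupp.single_nonneg.2 (hf e)

lemma fcost_sum_le {α : ℝ} (hα : 0 ≤ α) (hα1 : α ≤ 1) {ι : Type*} (s : Finset ι)
    (f : ι → WFlow m) (hf : ∀ i, 0 ≤ f i) :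
    fcost α (∑ i ∈ s, f i) ≤ ∑ i ∈ s, fcost α (f i) := by
  induction s using Finset.induction_on with
  | empty => simp [fcost]
  | insert i s his ih =>
    rw [Finset.sum_insert his, Finset.sum_insert his]
    exact (fcost_add_le hα hα1 (hf i) (Finset.sum_nonneg fun j _ => hf j)).trans
      (by linarith)

lemma fcost_push_le {α : ℝ} (hα : 0 ≤ α) (hα1 : α ≤ 1) (F : Pt m → Pt m) {f : WFlow m}
    (hf : 0 ≤ f) {T : Finset (Pt m × Pt m)} (hT : f.support ⊆ T) :
    fcost α (push F f) ≤ ∑ e ∈ T, massCost α (f e) * dist (F e.1) (F e.2) := by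
  have h : push F f = ∑ e ∈ T, Finsupp.single (F e.1, F e.2) (f e) :=
    Finsupp.sum_of_support_subset f hT _ (by simp)
  rw [h]
  refine (fcost_sum_le hα hα1 T _ fun e => Finsupp.single_nonneg.2 (hf e)).trans ?_
  exact (Finset.sum_congr rfl fun e _ => fcost_single α _ _ _).le

lemma fcost_push_le_fcost {α : ℝ} (hα : 0 ≤ α) (hα1 : α ≤ 1) {F : Pt m → Pt m}
    (hF : ∀ u v, dist (F u) (F v) ≤ dist u v) {f : WFlow m} (hf : 0 ≤ f) :
    fcost α (push F f) ≤ fcost α f := by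
  refine (fcost_push_le hα hα1 F hf subset_rfl).trans ?_
  rw [fcost_eq_sum α subset_rfl]
  refine Finset.sum_le_sum fun e _ => ?_
  exact mul_le_mul_of_nonneg_left (hF _ _) (massCost_nonneg α (hf e))

/-- A flow is circulation-free if its support carries no nonzero divergence-free flow. -/
def CirculationFree (f : WFlow m) : Prop :=
  ∀ g : WFlow m, g.support ⊆ f.support → div g = 0 → g = 0

lemma exists_add_smul_support_ssubset {f g : WFlow m} (hf : 0 ≤ f)
    (hgf : g.support ⊆ f.support) (hg : ∃ e, g e < 0) :
    ∃ θ : ℝ, 0 < θ ∧ 0 ≤ f + θ • g ∧ (f + θ • g).support ⊂ f.support := by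
  set N := f.support.filter fun e => g e < 0 with hN
  have hfpos : ∀ e ∈ f.support, 0 < f e := fun e he =>
    lt_of_le_of_ne (hf e) (Ne.symm (Finsupp.mem_support_iff.1 he))
  have hNne : N.Nonempty := by
    obtain ⟨e, he⟩ := hg
    exact ⟨e, Finset.mem_filter.2 ⟨hgf (Finsupp.mem_support_iff.2 he.ne), he⟩⟩
  obtain ⟨e₀, he₀, hmin⟩ := N.exists_min_image (fun e => f e / (-g e)) hNne
  obtain ⟨he₀f, he₀g⟩ := Finset.mem_filter.1 he₀
  have hθ : 0 < f e₀ / (-g e₀) := div_pos (hfpos e₀ he₀f) (by linarith)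
  refine ⟨f e₀ / (-g e₀), hθ, ?_, ?_⟩
  · intro e
    simp only [Finsupp.coe_add, Finsupp.coe_smul, Pi.add_apply, Pi.smul_apply, smul_eq_mul,
      Finsupp.coe_zero, Pi.zero_apply]
    by_cases hge : g e < 0
    · have he : e ∈ N := Finset.mem_filter.2
        ⟨hgf (Finsupp.mem_support_iff.2 hge.ne), hge⟩
      have h := hmin e he
      rw [le_div_iff₀ (by linarith)] at h
      linarith
    · have := mul_nonneg hθ.le (not_lt.1 hge)
      have := hf e
      simp only [Finsupp.coe_zero, Pi.zero_apply] at this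
      linarith
  · refine (Finset.ssubset_iff_of_subset ?_).2 ⟨e₀, he₀f, ?_⟩
    · refine Finsupp.support_add.trans (Finset.union_subset subset_rfl ?_)
      exact (Finsupp.support_smul).trans hgf
    · simp only [Finsupp.mem_support_iff, not_not, Finsupp.coe_add, Finsupp.coe_smul,
        Pi.add_apply, Pi.smul_apply, smul_eq_mul]
      have : g e₀ ≠ 0 := he₀g.ne
      field_simp
      ring

lemma fcost_le_or_fcost_le {α : ℝ} (hα : 0 ≤ α) (hα1 : α ≤ 1) {f g : WFlow m} {s t : ℝ}
    (hs : 0 < s) (ht : 0 < t) (hsf : 0 ≤ f + s • g) (htf : 0 ≤ f + t • (-g)) :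
    fcost α (f + s • g) ≤ fcost α f ∨ fcost α (f + t • (-g)) ≤ fcost α f := by
  by_contra! hcon
  obtain ⟨h1, h2⟩ := hcon
  set T := f.support ∪ g.support with hT
  have hT1 : (f + s • g).support ⊆ T := Finsupp.support_add.trans
    (Finset.union_subset_union subset_rfl Finsupp.support_smul)
  have hT2 : (f + t • (-g)).support ⊆ T := Finsupp.support_add.trans
    (Finset.union_subset_union subset_rfl (Finsupp.support_smul.trans
      (Finsupp.support_neg g).subset))
  have hst : 0 < s + t := by linarith
  have key : t / (s + t) * fcost α (f + s • g) + s / (s + t) * fcost α (f + t • (-g)) ≤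
      fcost α f := by
    rw [fcost_eq_sum α hT1, fcost_eq_sum α hT2,
      fcost_eq_sum α (Finset.subset_union_left (s₂ := g.support)), Finset.mul_sum,
      Finset.mul_sum, ← Finset.sum_add_distrib]
    refine Finset.sum_le_sum fun e _ => ?_
    have hc := (concaveOn_massCost hα hα1).2 (hsf e) (htf e)
      (show 0 ≤ t / (s + t) by positivity) (show 0 ≤ s / (s + t) by positivity)
      (by field_simp; ring)
    have hpt : (t / (s + t)) • (f + s • g) e + (s / (s + t)) • (f + t • (-g)) e = f e := by
      simp only [Finsupp.coe_add, Finsupp.coe_smul, Finsupp.coe_neg, Pi.add_apply,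
        Pi.smul_apply, Pi.neg_apply, smul_eq_mul]
      field_simp
      ring
    rw [hpt] at hc
    have := mul_le_mul_of_nonneg_right hc (dist_nonneg (x := e.1) (y := e.2))
    simp only [smul_eq_mul] at this
    linarith
  have e1 : t / (s + t) + s / (s + t) = 1 := by field_simp; ring
  have p1 : 0 < t / (s + t) := by positivity
  have p2 : 0 < s / (s + t) := by positivity
  have h3 := mul_lt_mul_of_pos_left h1 p1
  have h4 := mul_lt_mul_of_pos_left h2 p2
  have h5 : t / (s + t) * fcost α f + s / (s + t) * fcost α f = fcost α f := by
    rw [← add_mul, e1, one_mul]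
  linarith

lemma exists_circulationFree {α : ℝ} (hα : 0 ≤ α) (hα1 : α ≤ 1) {f : WFlow m} (hf : 0 ≤ f) :
    ∃ f' : WFlow m, 0 ≤ f' ∧ f'.support ⊆ f.support ∧ div f' = div f ∧
      fcost α f' ≤ fcost α f ∧ CirculationFree f' := by
  induction hc : f.support.card using Nat.strong_induction_on generalizing f with
  | _ c ih =>
    by_cases hcf : CirculationFree f
    · exact ⟨f, hf, subset_rfl, rfl, le_rfl, hcf⟩
    suffices h : ∃ f₁ : WFlow m, 0 ≤ f₁ ∧ div f₁ = div f ∧ fcost α f₁ ≤ fcost α f ∧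
        f₁.support ⊂ f.support by
      obtain ⟨f₁, h0, hd, hle, hss⟩ := h
      obtain ⟨f', h0', hs', hd', hle', hcf'⟩ := ih _ (hc ▸ Finset.card_lt_card hss) h0 rfl
      exact ⟨f', h0', hs'.trans hss.subset, hd'.trans hd, hle'.trans hle, hcf'⟩
    unfold CirculationFree at hcf
    push Not at hcf
    obtain ⟨g, hgf, hdg, hg⟩ := hcf
    have hdiv : ∀ θ : ℝ, div (f + θ • g) = div f := fun θ => by simp [hdg]
    have hdiv' : ∀ θ : ℝ, div (f + θ • (-g)) = div f := fun θ => by simp [hdg]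
    have hgf' : (-g).support ⊆ f.support := by rwa [Finsupp.support_neg]
    have mono : ∀ (θ : ℝ) (g' : WFlow m), 0 < θ → (∀ e, g' e ≤ 0) → 0 ≤ f + θ • g' →
        fcost α (f + θ • g') ≤ fcost α f := by
      intro θ g' hθ hg' h
      refine fcost_mono hα h fun e => ?_
      simp only [Finsupp.coe_add, Finsupp.coe_smul, Pi.add_apply, Pi.smul_apply, smul_eq_mul]
      nlinarith [hg' e]
    by_cases hneg : ∃ e, g e < 0
    · obtain ⟨s, hs, hs0, hss⟩ := exists_add_smul_support_ssubset hf hgf hneg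
      by_cases hpos : ∃ e, (-g) e < 0
      · obtain ⟨t, ht, ht0, hts⟩ := exists_add_smul_support_ssubset hf hgf' hpos
        rcases fcost_le_or_fcost_le hα hα1 hs ht hs0 ht0 with h | h
        · exact ⟨_, hs0, hdiv s, h, hss⟩
        · exact ⟨_, ht0, hdiv' t, h, hts⟩
      · push Not at hpos
        exact ⟨_, hs0, hdiv s, mono s g hs (fun e => by have := hpos e; simp at this; exact this)
          hs0, hss⟩
    · have hpos : ∃ e, (-g) e < 0 := by
        by_contra! hcon
        push Not at hneg
        refine hg (Finsupp.ext fun e => le_antisymm ?_ (hneg e))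
        have := hcon e
        simpa using this
      obtain ⟨t, ht, ht0, hts⟩ := exists_add_smul_support_ssubset hf hgf' hpos
      push Not at hneg
      exact ⟨_, ht0, hdiv' t, mono t (-g) ht (fun e => by simpa using hneg e) ht0, hts⟩

lemma CirculationFree.not_loop {f : WFlow m} (hf : CirculationFree f) {e : Pt m × Pt m}
    (he : e ∈ f.support) : e.1 ≠ e.2 := by
  obtain ⟨u, v⟩ := e
  rintro h
  have h : u = v := h
  subst h
  have := hf (Finsupp.single (u, u) 1)
    (Finsupp.support_single_subset.trans (Finset.singleton_subset_iff.2 he)) (by simp [div_single])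
  simp at this

/-- The directed edges of a flow. -/
def Adj (f : WFlow m) (u v : Pt m) : Prop := (u, v) ∈ f.support

lemma exists_unit_flow_of_reflTransGen {f : WFlow m} {u v : Pt m}
    (h : Relation.ReflTransGen (Adj f) u v) :
    ∃ g : WFlow m, 0 ≤ g ∧ g.support ⊆ f.support ∧
      div g = Finsupp.single u 1 - Finsupp.single v 1 := by
  induction h with
  | refl => exact ⟨0, le_rfl, by simp, by simp⟩
  | @tail b c _ hbc ih =>
    obtain ⟨g, hg0, hgs, hgd⟩ := ih
    refine ⟨g + Finsupp.single (b, c) 1,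
      add_nonneg hg0 (Finsupp.single_nonneg.2 zero_le_one), ?_, ?_⟩
    · exact Finsupp.support_add.trans (Finset.union_subset hgs
        (Finsupp.support_single_subset.trans (Finset.singleton_subset_iff.2 hbc)))
    · rw [map_add, hgd, div_single]
      abel

lemma CirculationFree.not_reflTransGen {f : WFlow m} (hf : CirculationFree f) {u v : Pt m}
    (huv : (u, v) ∈ f.support) : ¬ Relation.ReflTransGen (Adj f) v u := by
  intro h
  obtain ⟨g, hg0, hgs, hgd⟩ := exists_unit_flow_of_reflTransGen h
  have := hf (g + Finsupp.single (u, v) 1)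
    (Finsupp.support_add.trans (Finset.union_subset hgs
      (Finsupp.support_single_subset.trans (Finset.singleton_subset_iff.2 huv))))
    (by rw [map_add, hgd, div_single]; abel)
  have h1 := DFunLike.congr_fun this (u, v)
  have h2 := hg0 (u, v)
  simp at h1 h2
  linarith

/-- The underlying undirected graph of a flow. -/
def undirected (f : WFlow m) : SimpleGraph (Pt m) :=
  SimpleGraph.fromRel fun u v => (u, v) ∈ f.support

lemma exists_flow_of_reachable {T : Finset (Pt m × Pt m)} {H : SimpleGraph (Pt m)}
    (hH : ∀ u v, H.Adj u v → (u, v) ∈ T ∨ (v, u) ∈ T) {u v : Pt m} (h : H.Reachable u v) :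
    ∃ g : WFlow m, g.support ⊆ T ∧ div g = Finsupp.single u 1 - Finsupp.single v 1 := by
  rw [SimpleGraph.reachable_iff_reflTransGen] at h
  induction h with
  | refl => exact ⟨0, by simp, by simp⟩
  | @tail b c _ hbc ih =>
    obtain ⟨g, hgs, hgd⟩ := ih
    rcases hH _ _ hbc with hT | hT
    · refine ⟨g + Finsupp.single (b, c) 1, ?_, ?_⟩
      · exact Finsupp.support_add.trans (Finset.union_subset hgs
          (Finsupp.support_single_subset.trans (Finset.singleton_subset_iff.2 hT)))
      · rw [map_add, hgd, div_single]
        abel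
    · refine ⟨g + Finsupp.single (c, b) (-1), ?_, ?_⟩
      · exact Finsupp.support_add.trans (Finset.union_subset hgs
          (Finsupp.support_single_subset.trans (Finset.singleton_subset_iff.2 hT)))
      · rw [map_add, hgd, div_single]
        simp only [Finsupp.single_neg]
        abel

lemma CirculationFree.isAcyclic {f : WFlow m} (hf : CirculationFree f) :
    f.undirected.IsAcyclic := by
  rw [SimpleGraph.isAcyclic_iff_forall_isBridge]
  have key : ∀ u v : Pt m, (u, v) ∈ f.support →
      ¬ (f.undirected.deleteEdges {s(u, v)}).Reachable u v := by
    intro u v huv hreach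
    set T := f.support.filter fun e => s(e.1, e.2) ≠ s(u, v) with hT
    obtain ⟨g, hgs, hgd⟩ := exists_flow_of_reachable (T := T) (by
      intro a b hab
      rw [SimpleGraph.deleteEdges_adj] at hab
      obtain ⟨hab, hne⟩ := hab
      obtain ⟨_, hab⟩ := (SimpleGraph.fromRel_adj _ _ _).1 hab
      have hne : s(a, b) ≠ s(u, v) := hne
      rcases hab with hab | hab
      · exact Or.inl (Finset.mem_filter.2 ⟨hab, hne⟩)
      · refine Or.inr (Finset.mem_filter.2 ⟨hab, ?_⟩)
        rwa [Sym2.eq_swap]) hreach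
    have h0 : g (u, v) = 0 := by
      by_contra h
      exact (Finset.mem_filter.1 (hgs (Finsupp.mem_support_iff.2 h))).2 rfl
    have := hf (g + Finsupp.single (u, v) (-1))
      (Finsupp.support_add.trans (Finset.union_subset (hgs.trans (Finset.filter_subset _ _))
        (Finsupp.support_single_subset.trans (Finset.singleton_subset_iff.2 huv))))
      (by rw [map_add, hgd, div_single]; simp only [Finsupp.single_neg]; abel)
    have h1 := DFunLike.congr_fun this (u, v)
    simp [h0] at h1
  intro e he
  induction e using Sym2.ind with
  | _ u v =>
    rw [SimpleGraph.isBridge_iff]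
    obtain ⟨_, h⟩ := (SimpleGraph.fromRel_adj _ _ _).1 ((SimpleGraph.mem_edgeSet _).1 he)
    rcases h with h | h
    · exact key u v h
    · intro hr
      refine key v u h ?_
      rw [Sym2.eq_swap]
      exact hr.symm

lemma mapDomain_apply_eq_sum (p : Pt m × Pt m → Pt m) {f : WFlow m} {T : Finset (Pt m × Pt m)}
    (hT : f.support ⊆ T) (z : Pt m) :
    f.mapDomain p z = ∑ e ∈ T.filter (fun e => p e = z), f e := by
  have h : f.mapDomain p = ∑ e ∈ T, Finsupp.single (p e) (f e) :=
    Finsupp.sum_of_support_subset f hT _ (by simp)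
  rw [h, Finsupp.finsetSum_apply, Finset.sum_filter]
  exact Finset.sum_congr rfl fun e _ => Finsupp.single_apply

/-- The weighted graph carrying a flow, with additional vertices `V`. -/
def toGraph (f : WFlow m) (V : Finset (Pt m)) : WDG m where
  V := f.support.image Prod.fst ∪ f.support.image Prod.snd ∪ V
  E := f.support
  w := f

lemma cost_toGraph (α : ℝ) {f : WFlow m} (V : Finset (Pt m)) :
    (f.toGraph V).cost α = fcost α f := by
  unfold WDG.cost fcost Finsupp.sum
  refine Finset.sum_congr rfl fun e he => ?_
  have h : massCost α (f e) = f e ^ α := if_neg (Finsupp.mem_support_iff.1 he)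
  simp only [h]
  rfl

lemma CirculationFree.isTransportPath_toGraph {f : WFlow m} (hcf : CirculationFree f)
    (hf : 0 ≤ f) {X : Set (Pt m)} (hX : ∀ e ∈ f.support, e.1 ∈ X ∧ e.2 ∈ X)
    {a b : Pt m →₀ ℝ} (ha : ↑a.support ⊆ X) (hb : ↑b.support ⊆ X) (hdiv : div f = a - b) :
    IsTransportPath X (f.toGraph (a.support ∪ b.support)) a b := by
  refine ⟨?_, ?_, ?_, ?_, hcf.isAcyclic, ?_⟩
  · intro e he
    have he : e ∈ f.support := he
    refine ⟨?_, ?_, hcf.not_loop he, lt_of_le_of_ne (hf e) (Ne.symm (Finsupp.mem_support_iff.1 he))⟩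
    · exact Finset.mem_union_left _ (Finset.mem_union_left _ (Finset.mem_image_of_mem _ he))
    · exact Finset.mem_union_left _ (Finset.mem_union_right _ (Finset.mem_image_of_mem _ he))
  · intro z hz
    simp only [toGraph, Finset.coe_union, Finset.coe_image] at hz
    rcases hz with (⟨e, he, rfl⟩ | ⟨e, he, rfl⟩) | hz | hz
    · exact (hX e he).1
    · exact (hX e he).2
    · exact ha hz
    · exact hb hz
  · exact fun z hz => Finset.mem_union_right _ (Finset.mem_union_left _ hz)
  · exact fun z hz => Finset.mem_union_right _ (Finset.mem_union_right _ hz)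
  · intro z
    have h := DFunLike.congr_fun hdiv z
    rw [div_apply, Finsupp.sub_apply, Finsupp.sub_apply, mapDomain_apply_eq_sum _ subset_rfl,
      mapDomain_apply_eq_sum _ subset_rfl] at h
    exact h

end WFlow

lemma WDG.cost_nonneg {m : ℕ} {G : WDG m} (α : ℝ) (hG : G.edgesOK) : 0 ≤ G.cost α :=
  Finset.sum_nonneg fun e he =>
    mul_nonneg (Real.rpow_nonneg (hG e he).2.2.2.le _) dist_nonneg

lemma IsTransportPath.exists_flow {m : ℕ} {X : Set (Pt m)} {G : WDG m} {a b : Pt m →₀ ℝ}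
    (hG : IsTransportPath X G a b) (α : ℝ) :
    ∃ f : WFlow m, 0 ≤ f ∧ WFlow.div f = a - b ∧ WFlow.fcost α f = G.cost α := by
  obtain ⟨hE, -, -, -, -, hbal⟩ := hG
  set f : WFlow m := Finsupp.indicator G.E fun e _ => G.w e with hfdef
  have hfe : ∀ e ∈ G.E, f e = G.w e := fun e he => Finsupp.indicator_of_mem he _
  have hs : f.support ⊆ G.E := Finsupp.support_indicator_subset _ _
  refine ⟨f, ?_, ?_, ?_⟩
  · intro e
    by_cases he : e ∈ G.E
    · rw [hfe e he]
      exact (hE e he).2.2.2.le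
    · rw [hfdef, Finsupp.indicator_of_notMem he]
      exact le_rfl
  · ext z
    rw [WFlow.div_apply, Finsupp.sub_apply, Finsupp.sub_apply, ← hbal z,
      WFlow.mapDomain_apply_eq_sum _ hs, WFlow.mapDomain_apply_eq_sum _ hs]
    unfold WDG.outflow WDG.inflow
    congr 1 <;>
    exact Finset.sum_congr rfl fun e he => hfe e (Finset.mem_filter.1 he).1
  · rw [WFlow.fcost_eq_sum α hs]
    refine Finset.sum_congr rfl fun e he => ?_
    rw [hfe e he, massCost_of_pos α (hE e he).2.2.2]

/-- Nonexpansive retraction onto a compact convex set. -/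
lemma exists_nonexpansive_retraction {m : ℕ} {X : Set (Pt m)} (hX : IsCompact X)
    (hXc : Convex ℝ X) (hne : X.Nonempty) :
    ∃ P : Pt m → Pt m, (∀ z, P z ∈ X) ∧ (∀ z ∈ X, P z = z) ∧
      ∀ z z', dist (P z) (P z') ≤ dist z z' := by
  choose P hPX hP using fun z : Pt m =>
    exists_norm_eq_iInf_of_complete_convex hne hX.isComplete hXc z
  have hin : ∀ z, ∀ y ∈ X, ⟪z - P z, y - P z⟫ ≤ 0 := fun z =>
    (norm_eq_iInf_iff_real_inner_le_zero hXc (hPX z)).1 (hP z)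
  refine ⟨P, hPX, ?_, ?_⟩
  · intro z hz
    have h := hin z z hz
    rw [real_inner_self_eq_norm_sq] at h
    have h0 : ‖z - P z‖ = 0 := by nlinarith [norm_nonneg (z - P z)]
    exact (sub_eq_zero.1 (norm_eq_zero.1 h0)).symm
  · intro z z'
    rw [dist_eq_norm, dist_eq_norm]
    have h1 := hin z (P z') (hPX z')
    have h2 := hin z' (P z) (hPX z)
    have h3 : ⟪P z - P z', P z - P z'⟫ ≤ ⟪z - z', P z - P z'⟫ := by
      have e : ⟪z - z', P z - P z'⟫ - ⟪P z - P z', P z - P z'⟫ =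
          -⟪z - P z, P z' - P z⟫ - ⟪z' - P z', P z - P z'⟫ := by
        rw [← inner_sub_left, ← inner_neg_right, neg_sub, ← inner_sub_left]
        congr 1
        abel
      linarith
    rw [real_inner_self_eq_norm_sq] at h3
    have h4 := real_inner_le_norm (z - z') (P z - P z')
    by_contra! hcon
    nlinarith [norm_nonneg (z - z'), norm_nonneg (P z - P z')]

lemma exists_transportPath_cost_le {m : ℕ} {X : Set (Pt m)} (hX : IsCompact X)
    (hXc : Convex ℝ X) (hne : X.Nonempty) {α : ℝ} (hα : 0 ≤ α) (hα1 : α ≤ 1) {f : WFlow m}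
    (hf : 0 ≤ f) {a b : Pt m →₀ ℝ} (ha : ↑a.support ⊆ X) (hb : ↑b.support ⊆ X)
    (hdiv : WFlow.div f = a - b) :
    ∃ G, IsTransportPath X G a b ∧ G.cost α ≤ WFlow.fcost α f := by
  obtain ⟨P, hPX, hPid, hPle⟩ := exists_nonexpansive_retraction hX hXc hne
  have hmap : ∀ c : Pt m →₀ ℝ, ↑c.support ⊆ X → c.mapDomain P = c := by
    intro c hc
    conv_rhs => rw [← Finsupp.mapDomain_id (v := c)]
    exact Finsupp.mapDomain_congr fun z hz => hPid z (hc hz)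
  have hdiv' : WFlow.div (WFlow.push P f) = a - b := by
    rw [WFlow.div_push, hdiv]
    have h : (a - b).mapDomain P = Finsupp.lmapDomain ℝ ℝ P (a - b) := rfl
    rw [h, map_sub, Finsupp.lmapDomain_apply, Finsupp.lmapDomain_apply, hmap a ha, hmap b hb]
  have hX' : ∀ e ∈ (WFlow.push P f).support, e.1 ∈ X ∧ e.2 ∈ X := by
    intro e he
    obtain ⟨e', -, rfl⟩ := Finset.mem_image.1 (Finsupp.mapDomain_support he)
    exact ⟨hPX _, hPX _⟩
  obtain ⟨g, hg0, hgs, hgd, hgc, hcf⟩ :=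
    WFlow.exists_circulationFree hα hα1 (WFlow.push_nonneg P hf)
  refine ⟨_, hcf.isTransportPath_toGraph hg0 (fun e he => hX' e (hgs he)) ha hb
    (hgd.trans hdiv'), ?_⟩
  rw [WFlow.cost_toGraph]
  exact hgc.trans (WFlow.fcost_push_le_fcost hα hα1 hPle hf)

lemma bddBelow_cost {m : ℕ} (X : Set (Pt m)) (α : ℝ) (a b : Pt m →₀ ℝ) :
    BddBelow (WDG.cost α '' {G : WDG m | IsTransportPath X G a b}) :=
  ⟨0, by rintro _ ⟨G, hG, rfl⟩; exact WDG.cost_nonneg α hG.1⟩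

lemma dCost_le_fcost {m : ℕ} {X : Set (Pt m)} (hX : IsCompact X)
    (hXc : Convex ℝ X) (hne : X.Nonempty) {α : ℝ} (hα : 0 ≤ α) (hα1 : α ≤ 1) {f : WFlow m}
    (hf : 0 ≤ f) {a b : Pt m →₀ ℝ} (ha : ↑a.support ⊆ X) (hb : ↑b.support ⊆ X)
    (hdiv : WFlow.div f = a - b) : dCost X α a b ≤ WFlow.fcost α f := by
  obtain ⟨G, hG, hGc⟩ := exists_transportPath_cost_le hX hXc hne hα hα1 hf ha hb hdiv
  exact (csInf_le (bddBelow_cost X α a b) ⟨G, hG, rfl⟩).trans hGc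

lemma exists_flow_fcost_lt {m : ℕ} {X : Set (Pt m)} {α : ℝ} (hα : 0 ≤ α) (hα1 : α ≤ 1)
    {a b : Pt m →₀ ℝ} (hne : ∃ G, IsTransportPath X G a b) {c : ℝ} (hc : dCost X α a b < c) :
    ∃ f : WFlow m, 0 ≤ f ∧ WFlow.div f = a - b ∧ WFlow.fcost α f < c ∧
      WFlow.CirculationFree f := by
  obtain ⟨G₀, hG₀⟩ := hne
  obtain ⟨_, ⟨G, hG, rfl⟩, hGc⟩ := exists_lt_of_csInf_lt (Set.Nonempty.image _ ⟨G₀, hG₀⟩) hc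
  obtain ⟨f, hf, hfd, hfc⟩ := IsTransportPath.exists_flow hG α
  obtain ⟨g, hg0, -, hgd, hgc, hcf⟩ := WFlow.exists_circulationFree hα hα1 hf
  exact ⟨g, hg0, hgd.trans hfd, (hgc.trans hfc.le).trans_lt hGc, hcf⟩

namespace WFlow

variable {m : ℕ}

lemma linearCombination_div (κ : Pt m → ℝ) {f : WFlow m} {T : Finset (Pt m × Pt m)}
    (hT : f.support ⊆ T) :
    Finsupp.linearCombination ℝ κ (div f) = ∑ e ∈ T, f e * (κ e.1 - κ e.2) := by
  rw [div_apply, map_sub, Finsupp.linearCombination_mapDomain,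
    Finsupp.linearCombination_mapDomain, Finsupp.linearCombination_apply,
    Finsupp.linearCombination_apply, Finsupp.sum_of_support_subset f hT _ (by simp),
    Finsupp.sum_of_support_subset f hT _ (by simp), ← Finset.sum_sub_distrib]
  refine Finset.sum_congr rfl fun e _ => ?_
  simp only [smul_eq_mul, Function.comp]
  ring

/-- Part of the demand of a flow is served by a subflow: route at every vertex the
fraction of mass given by a fixed point of the downstream averaging operator. -/
lemma exists_subflow {f : WFlow m} (hf : 0 ≤ f) {a b₁ b₂ : Pt m →₀ ℝ} (h₁ : 0 ≤ b₁)
    (h₂ : 0 ≤ b₂) (hdiv : div f = a - (b₁ + b₂)) :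
    ∃ (h : Pt m → ℝ) (g : WFlow m), 0 ≤ g ∧ g ≤ f ∧ ∀ z, div g z = h z * a z - b₁ z := by
  set out : Pt m → ℝ := fun z => ∑ e ∈ f.support.filter (fun e => e.1 = z), f e with hout
  set num : (Pt m → unitInterval) → Pt m → ℝ := fun h z =>
    b₁ z + ∑ e ∈ f.support.filter (fun e => e.1 = z), f e * h e.2 with hnum
  set den : Pt m → ℝ := fun z => b₁ z + b₂ z + out z with hden
  have hout0 : ∀ z, 0 ≤ out z := fun z => Finset.sum_nonneg fun e _ => hf e
  have hden0 : ∀ z, 0 ≤ den z := fun z => add_nonneg (add_nonneg (h₁ z) (h₂ z)) (hout0 z)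
  have hnum0 : ∀ h z, 0 ≤ num h z := fun h z => add_nonneg (h₁ z)
    (Finset.sum_nonneg fun e _ => mul_nonneg (hf e) (h e.2).2.1)
  have hnumden : ∀ h z, num h z ≤ den z := by
    intro h z
    have hs : ∑ e ∈ f.support.filter (fun e => e.1 = z), f e * h e.2 ≤ out z :=
      Finset.sum_le_sum fun e _ => mul_le_of_le_one_right (hf e) (h e.2).2.2
    have := h₂ z
    simp only [Finsupp.coe_zero, Pi.zero_apply] at this
    simp only [hnum, hden]
    linarith
  let T : (Pt m → unitInterval) →o (Pt m → unitInterval) :=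
    { toFun := fun h z => ⟨num h z / den z, div_nonneg (hnum0 h z) (hden0 z),
        div_le_one_of_le₀ (hnumden h z) (hden0 z)⟩
      monotone' := by
        intro h h' hh z
        refine Subtype.coe_le_coe.1 ?_
        refine div_le_div_of_nonneg_right ?_ (hden0 z)
        refine add_le_add le_rfl (Finset.sum_le_sum fun e _ => ?_)
        exact mul_le_mul_of_nonneg_left (Subtype.coe_le_coe.2 (hh e.2)) (hf e) }
  set h := OrderHom.lfp T with hh
  have hfix : ∀ z, (h z : ℝ) * den z = num h z := by
    intro z
    have e : (h z : ℝ) = num h z / den z := by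
      have := congrFun (OrderHom.map_lfp T) z
      rw [← hh] at this
      exact congrArg Subtype.val this.symm
    by_cases hd : den z = 0
    · have := hnumden h z
      have := hnum0 h z
      rw [hd, mul_zero]
      linarith
    · rw [e, div_mul_cancel₀ _ hd]
  set g : WFlow m := Finsupp.indicator f.support fun e _ => f e * h e.2 with hg
  have hge : ∀ e, g e = f e * h e.2 := by
    intro e
    by_cases he : e ∈ f.support
    · exact Finsupp.indicator_of_mem he _
    · rw [hg, Finsupp.indicator_of_notMem he, Finsupp.notMem_support_iff.1 he, zero_mul]
  have hgs : g.support ⊆ f.support := Finsupp.support_indicator_subset _ _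
  refine ⟨fun z => h z, g, ?_, ?_, ?_⟩
  · intro e
    rw [hge e]
    exact mul_nonneg (hf e) (h e.2).2.1
  · intro e
    rw [hge e]
    exact mul_le_of_le_one_right (hf e) (h e.2).2.2
  · intro z
    have hb := DFunLike.congr_fun hdiv z
    rw [div_apply, Finsupp.sub_apply, mapDomain_apply_eq_sum _ subset_rfl,
      mapDomain_apply_eq_sum _ subset_rfl, Finsupp.sub_apply, Finsupp.add_apply] at hb
    rw [div_apply, Finsupp.sub_apply, mapDomain_apply_eq_sum _ hgs,
      mapDomain_apply_eq_sum _ hgs]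
    have hin : ∑ e ∈ f.support.filter (fun e => e.2 = z), g e =
        h z * ∑ e ∈ f.support.filter (fun e => e.2 = z), f e := by
      rw [Finset.mul_sum]
      refine Finset.sum_congr rfl fun e he => ?_
      rw [hge, (Finset.mem_filter.1 he).2, mul_comm]
    have hou : ∑ e ∈ f.support.filter (fun e => e.1 = z), g e = num h z - b₁ z := by
      simp only [hnum, hge]
      ring
    rw [hin, hou, ← hfix z]
    simp only [hden, hout]
    linear_combination (h z : ℝ) * hb

/-- No edge of a subflow of a circulation-free flow carries more than the mass supplied. -/
lemma CirculationFree.le_mass {f g : WFlow m} (hcf : CirculationFree f) (hg : 0 ≤ g)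
    (hgf : g.support ⊆ f.support) {x : Pt m} {M : ℝ} (hM : 0 ≤ M) {b : Pt m →₀ ℝ} (hb : 0 ≤ b)
    (hdiv : div g = Finsupp.single x M - b) (hbM : Finsupp.linearCombination ℝ (fun _ => (1 : ℝ)) b = M)
    (e : Pt m × Pt m) : g e ≤ M := by
  by_cases he : e ∈ g.support
  swap
  · rwa [Finsupp.notMem_support_iff.1 he]
  set κ : Pt m → ℝ := fun z => if Relation.ReflTransGen (Adj f) e.2 z then 1 else 0 with hκ
  have hκ0 : ∀ z, 0 ≤ κ z := fun z => by simp only [hκ]; split_ifs <;> norm_num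
  have hκ1 : ∀ z, κ z ≤ 1 := fun z => by simp only [hκ]; split_ifs <;> norm_num
  have h := linearCombination_div κ (subset_rfl : g.support ⊆ g.support)
  rw [hdiv, map_sub, Finsupp.linearCombination_single, smul_eq_mul] at h
  have hterm : ∀ e' ∈ g.support, g e' * (κ e'.1 - κ e'.2) ≤ 0 := by
    intro e' he'
    refine mul_nonpos_of_nonneg_of_nonpos (hg e') ?_
    by_cases hr : Relation.ReflTransGen (Adj f) e.2 e'.1
    · have hr' : Relation.ReflTransGen (Adj f) e.2 e'.2 := hr.tail (hgf he')
      simp [hκ, hr, hr']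
    · have : κ e'.1 = 0 := if_neg hr
      linarith [hκ0 e'.2]
  have hsum : ∑ e' ∈ g.support, g e' * (κ e'.1 - κ e'.2) ≤ g e * (κ e.1 - κ e.2) := by
    rw [← Finset.add_sum_erase _ _ he]
    have := Finset.sum_nonpos fun e' he' =>
      hterm e' (Finset.mem_of_mem_erase (a := e) he')
    linarith
  have h1 : κ e.1 = 0 := if_neg (hcf.not_reflTransGen (hgf he))
  have h2 : κ e.2 = 1 := if_pos Relation.ReflTransGen.refl
  have hbκ : Finsupp.linearCombination ℝ κ b ≤ M := by
    rw [← hbM, Finsupp.linearCombination_apply, Finsupp.linearCombination_apply]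
    exact Finset.sum_le_sum fun z _ => mul_le_mul_of_nonneg_left (hκ1 z) (hb z)
  have := mul_nonneg hM (hκ0 x)
  rw [h1, h2] at hsum
  linarith

end WFlow

section Geometry

lemma dist_add_le_of_collapse {m : ℕ} {π : Pt m → ℝ} (hπ : ∀ z z' (s : ℝ),
      π (AffineMap.lineMap z z' s) = AffineMap.lineMap (π z) (π z') s)
    {d₁ d₂ : Pt m → Pt m → ℝ}
    (t₁ : ∀ z z' z'', d₁ z z'' ≤ d₁ z z' + d₁ z' z'')
    (t₂ : ∀ z z' z'', d₂ z z'' ≤ d₂ z z' + d₂ z' z'')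
    (s₁ : ∀ z z', d₁ z z' = d₁ z' z) (s₂ : ∀ z z', d₂ z z' = d₂ z' z)
    (l₁ : ∀ z z', d₁ z z' ≤ dist z z') (l₂ : ∀ z z', d₂ z z' ≤ dist z z') {c : ℝ}
    (c₁ : ∀ z z', π z ≤ c → π z' ≤ c → d₁ z z' = 0)
    (c₂ : ∀ z z', c ≤ π z → c ≤ π z' → d₂ z z' = 0) (z z' : Pt m) :
    d₁ z z' + d₂ z z' ≤ dist z z' := by
  wlog h : π z ≤ π z' generalizing z z'
  · rw [s₁, s₂, dist_comm]
    exact this z' z (le_of_not_ge h)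
  rcases le_total c (π z) with hz | hz
  · rw [c₂ z z' hz (hz.trans h), add_zero]
    exact l₁ z z'
  rcases le_total (π z') c with hz' | hz'
  · rw [c₁ z z' hz hz', zero_add]
    exact l₂ z z'
  rcases h.eq_or_lt with heq | hlt
  · rw [c₁ z z' hz (heq ▸ hz), zero_add]
    exact l₂ z z'
  set s := (c - π z) / (π z' - π z) with hs
  set q : Pt m := AffineMap.lineMap z z' s with hq
  have hden : 0 < π z' - π z := by linarith
  have hs0 : 0 ≤ s := div_nonneg (by linarith) hden.le
  have hs1 : s ≤ 1 := div_le_one_of_le₀ (by linarith) hden.le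
  have hπq : π q = c := by
    rw [hq, hπ, AffineMap.lineMap_apply_module', smul_eq_mul, hs, div_mul_cancel₀ _ hden.ne']
    ring
  have e1 : dist z q = s * dist z z' := by
    rw [hq, dist_left_lineMap, Real.norm_of_nonneg hs0]
  have e2 : dist q z' = (1 - s) * dist z z' := by
    rw [hq, dist_lineMap_right, Real.norm_of_nonneg (by linarith)]
  have a1 := t₁ z q z'
  rw [c₁ z q hz hπq.le] at a1
  have a2 := t₂ z q z'
  rw [c₂ q z' hπq.ge hz'] at a2
  have b1 := l₁ q z'
  have b2 := l₂ z q
  rw [e2] at b1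
  rw [e1] at b2
  linarith

variable {m : ℕ}

/-- The component of `z - p` orthogonal to `v`. -/
def perp (p v z : Pt m) : Pt m := z - p - proj p v z • v

/-- The part of the half-space `t ≤ π` within distance `R` of the axis is kept, and the
part behind it is swept into the shrinking ball of radius `R - (t - π)` around the axis. -/
def collapse (p v : Pt m) (R t : ℝ) (z : Pt m) : Pt m :=
  p + max (proj p v z) t • v +
    (min ‖perp p v z‖ (max (R - max (t - proj p v z) 0) 0) / ‖perp p v z‖) • perp p v z

lemma collapse_of_le {p v : Pt m} {R t : ℝ} {z : Pt m} (hz : t ≤ proj p v z)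
    (hzR : ‖perp p v z‖ ≤ R) : collapse p v R t z = z := by
  have h0 := norm_nonneg (perp p v z)
  have h : (min ‖perp p v z‖ (max (R - max (t - proj p v z) 0) 0) / ‖perp p v z‖) •
      perp p v z = perp p v z := by
    rw [max_eq_right (by linarith : t - proj p v z ≤ 0), sub_zero, max_eq_left (h0.trans hzR),
      min_eq_left hzR]
    by_cases hp : perp p v z = 0
    · simp [hp]
    · rw [div_self (norm_ne_zero_iff.2 hp), one_smul]
  rw [collapse, h, max_eq_left hz, perp]
  abel

lemma collapse_of_le_sub {p v : Pt m} {R t : ℝ} (hR : 0 ≤ R) {z : Pt m}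
    (hz : proj p v z ≤ t - R) : collapse p v R t z = p + t • v := by
  rw [collapse, max_eq_right (by linarith : proj p v z ≤ t),
    max_eq_left (by linarith : 0 ≤ t - proj p v z),
    max_eq_right (by linarith : R - (t - proj p v z) ≤ 0), min_eq_right (norm_nonneg _)]
  simp

lemma inner_perp {p v : Pt m} (hv : ‖v‖ = 1) (z : Pt m) : ⟪perp p v z, v⟫ = 0 := by
  rw [perp, inner_sub_left, real_inner_smul_left, real_inner_self_eq_norm_sq, hv, proj]
  ring

lemma norm_smul_sub_smul_sq_le (ρ ρ' : Pt m) {s s' : ℝ} (hs0 : 0 ≤ s) (hs : s ≤ ‖ρ‖)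
    (hs0' : 0 ≤ s') (hs' : s' ≤ ‖ρ'‖) :
    ‖(s / ‖ρ‖) • ρ - (s' / ‖ρ'‖) • ρ'‖ ^ 2 ≤
      (s - s') ^ 2 + ‖ρ - ρ'‖ ^ 2 - (‖ρ‖ - ‖ρ'‖) ^ 2 := by
  rw [norm_sub_sq_real, norm_sub_sq_real, norm_smul, norm_smul, real_inner_smul_left,
    real_inner_smul_right, Real.norm_of_nonneg (div_nonneg hs0 (norm_nonneg _)),
    Real.norm_of_nonneg (div_nonneg hs0' (norm_nonneg _))]
  have hI := real_inner_le_norm ρ ρ'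
  rcases (norm_nonneg ρ).eq_or_lt with h | h
  · have hs1 : s = 0 := le_antisymm (h ▸ hs) hs0
    have hρ : ρ = 0 := norm_eq_zero.1 h.symm
    subst hρ
    rw [hs1]
    by_cases h' : ‖ρ'‖ = 0
    · simp [h', sq_nonneg]
    · rw [div_mul_cancel₀ _ h']
      simp
  rcases (norm_nonneg ρ').eq_or_lt with h' | h'
  · have hs1 : s' = 0 := le_antisymm (h' ▸ hs') hs0'
    have hρ : ρ' = 0 := norm_eq_zero.1 h'.symm
    subst hρ
    rw [hs1, div_mul_cancel₀ _ h.ne']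
    simp
  rw [div_mul_cancel₀ _ h.ne', div_mul_cancel₀ _ h'.ne']
  set A := ‖ρ‖
  set B := ‖ρ'‖
  have hs1 : s / A ≤ 1 := (div_le_one h).2 hs
  have hs1' : s' / B ≤ 1 := (div_le_one h').2 hs'
  have hu : 0 ≤ s / A := by positivity
  have hu' : 0 ≤ s' / B := by positivity
  have hle : s / A * (s' / B) ≤ 1 := mul_le_one₀ hs1 hu' hs1'
  have hss : s * s' = s / A * (s' / B) * (A * B) := by field_simp
  nlinarith [mul_nonneg (sub_nonneg.2 hle) (sub_nonneg.2 hI)]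

lemma norm_axis_add_sq {v ρ : Pt m} (hv : ‖v‖ = 1) (hρ : ⟪ρ, v⟫ = 0) (c : ℝ) :
    ‖c • v + ρ‖ ^ 2 = c ^ 2 + ‖ρ‖ ^ 2 := by
  rw [norm_add_sq_real, real_inner_smul_left, real_inner_comm, hρ, norm_smul, hv]
  simp

lemma dist_collapse_le {p v : Pt m} (hv : ‖v‖ = 1) (R t : ℝ) (z z' : Pt m) :
    dist (collapse p v R t z) (collapse p v R t z') ≤ dist z z' := by
  rw [dist_eq_norm, dist_eq_norm]
  refine (pow_le_pow_iff_left₀ (norm_nonneg _) (norm_nonneg _) two_ne_zero).1 ?_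
  have hz : z - z' = (proj p v z - proj p v z') • v + (perp p v z - perp p v z') := by
    simp only [perp, sub_smul]
    abel
  have hρ : ⟪perp p v z - perp p v z', v⟫ = 0 := by
    rw [inner_sub_left, inner_perp hv, inner_perp hv, sub_zero]
  rw [hz, norm_axis_add_sq hv hρ]
  set x := proj p v z
  set x' := proj p v z'
  set ρ := perp p v z with hρdef
  set ρ' := perp p v z' with hρdef'
  set r := max (R - max (t - x) 0) 0 with hr
  set r' := max (R - max (t - x') 0) 0 with hr'
  have hc : collapse p v R t z - collapse p v R t z' =
      (max x t - max x' t) • v + ((min ‖ρ‖ r / ‖ρ‖) • ρ - (min ‖ρ'‖ r' / ‖ρ'‖) • ρ') := by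
    simp only [collapse, sub_smul]
    abel
  have ho : ⟪(min ‖ρ‖ r / ‖ρ‖) • ρ - (min ‖ρ'‖ r' / ‖ρ'‖) • ρ', v⟫ = 0 := by
    rw [inner_sub_left, real_inner_smul_left, real_inner_smul_left, inner_perp hv, inner_perp hv]
    ring
  rw [hc, norm_axis_add_sq hv ho]
  have h1 := norm_smul_sub_smul_sq_le ρ ρ' (le_min (norm_nonneg ρ) (le_max_right _ 0))
    (min_le_left _ r) (le_min (norm_nonneg ρ') (le_max_right _ 0)) (min_le_left _ r')
  have h2 : |r - r'| ≤ |max (t - x) 0 - max (t - x') 0| := by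
    have := abs_max_sub_max_le_abs (R - max (t - x) 0) (R - max (t - x') 0) 0
    rw [sub_sub_sub_cancel_left, abs_sub_comm (max (t - x') 0)] at this
    exact this
  have h3 : (min ‖ρ‖ r - min ‖ρ'‖ r') ^ 2 ≤
      (‖ρ‖ - ‖ρ'‖) ^ 2 + (max (t - x) 0 - max (t - x') 0) ^ 2 := by
    have h4 := abs_min_sub_min_le_max ‖ρ‖ r ‖ρ'‖ r'
    rcases le_max_iff.1 h4 with h | h
    · have := sq_le_sq.2 h
      nlinarith [sq_nonneg (max (t - x) 0 - max (t - x') 0)]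
    · have := sq_le_sq.2 (h.trans h2)
      nlinarith [sq_nonneg (‖ρ‖ - ‖ρ'‖)]
  have h5 : (max x t - max x' t) ^ 2 + (max (t - x) 0 - max (t - x') 0) ^ 2 ≤
      (x - x') ^ 2 := by
    rcases le_total x t with h | h <;> rcases le_total x' t with h' | h'
    · rw [max_eq_right h, max_eq_right h', max_eq_left (by linarith), max_eq_left (by linarith)]
      nlinarith
    · rw [max_eq_right h, max_eq_left h', max_eq_left (by linarith), max_eq_right (by linarith)]
      nlinarith [mul_nonneg (sub_nonneg.2 h) (sub_nonneg.2 h')]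
    · rw [max_eq_left h, max_eq_right h', max_eq_right (by linarith), max_eq_left (by linarith)]
      nlinarith [mul_nonneg (sub_nonneg.2 h) (sub_nonneg.2 h')]
    · rw [max_eq_left h, max_eq_left h', max_eq_right (by linarith), max_eq_right (by linarith)]
      nlinarith
  linarith

lemma proj_lineMap (p v z z' : Pt m) (s : ℝ) :
    proj p v (AffineMap.lineMap z z' s) = AffineMap.lineMap (proj p v z) (proj p v z') s := by
  have h : (AffineMap.lineMap z z' s : Pt m) - p = (z - p) + s • ((z' - p) - (z - p)) := by
    rw [AffineMap.lineMap_apply_module', sub_sub_sub_cancel_right]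
    abel
  rw [proj, h, inner_add_left, real_inner_smul_left, inner_sub_left (z' - p) (z - p),
    AffineMap.lineMap_apply_module', smul_eq_mul]
  simp only [proj]
  ring

lemma abs_proj_sub_le {p v : Pt m} (hv : ‖v‖ = 1) (z z' : Pt m) :
    |proj p v z - proj p v z'| ≤ dist z z' := by
  have h : proj p v z - proj p v z' = ⟪z - z', v⟫ := by
    rw [proj, proj, ← inner_sub_left, sub_sub_sub_cancel_right]
  rw [h, dist_eq_norm]
  simpa [hv] using abs_real_inner_le_norm (z - z') v

lemma proj_neg (p v z : Pt m) : proj p (-v) z = -proj p v z := inner_neg_right _ _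

lemma perp_neg (p v z : Pt m) : perp p (-v) z = perp p v z := by
  simp [perp, proj_neg]

/-- The two collapse maps and the projection onto the middle strip share out the length. -/
lemma dist_collapse_add_le {p v : Pt m} (hv : ‖v‖ = 1) {R t₁ t₂ : ℝ} (hR : 0 ≤ R)
    (ht : t₁ + R ≤ t₂ - R) (z z' : Pt m) :
    dist (collapse p v R t₂ z) (collapse p v R t₂ z') +
      (|max (min (proj p v z) (t₂ - R)) (t₁ + R) - max (min (proj p v z') (t₂ - R)) (t₁ + R)| +
      dist (collapse p (-v) R (-t₁) z) (collapse p (-v) R (-t₁) z')) ≤ dist z z' := by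
  have hv' : ‖-v‖ = 1 := by rwa [norm_neg]
  have hclamp : ∀ z z' : Pt m, |max (min (proj p v z) (t₂ - R)) (t₁ + R) -
      max (min (proj p v z') (t₂ - R)) (t₁ + R)| ≤ dist z z' := by
    intro z z'
    refine (abs_max_sub_max_le_abs _ _ _).trans (le_trans ?_ (abs_proj_sub_le (p := p) hv z z'))
    refine (abs_min_sub_min_le_max _ _ _ _).trans ?_
    simp
  have hstrip : ∀ z z' : Pt m,
      |max (min (proj p v z) (t₂ - R)) (t₁ + R) - max (min (proj p v z') (t₂ - R)) (t₁ + R)| +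
      dist (collapse p (-v) R (-t₁) z) (collapse p (-v) R (-t₁) z') ≤ dist z z' := by
    refine dist_add_le_of_collapse (π := proj p v) (c := t₁ + R) (proj_lineMap p v)
      (d₁ := fun z z' => |max (min (proj p v z) (t₂ - R)) (t₁ + R) -
        max (min (proj p v z') (t₂ - R)) (t₁ + R)|)
      (d₂ := fun z z' => dist (collapse p (-v) R (-t₁) z) (collapse p (-v) R (-t₁) z'))
      (fun _ _ _ => abs_sub_le _ _ _) (fun _ _ _ => dist_triangle _ _ _)
      (fun _ _ => abs_sub_comm _ _) (fun _ _ => dist_comm _ _) hclamp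
      (dist_collapse_le hv' R _) ?_ ?_
    · intro z z' h h'
      rw [max_eq_right ((min_le_left _ _).trans h), max_eq_right ((min_le_left _ _).trans h'),
        sub_self, abs_zero]
    · intro z z' h h'
      rw [collapse_of_le_sub hR (by rw [proj_neg]; linarith),
        collapse_of_le_sub hR (by rw [proj_neg]; linarith), dist_self]
  refine dist_add_le_of_collapse (π := proj p v) (c := t₂ - R) (proj_lineMap p v)
    (d₁ := fun z z' => dist (collapse p v R t₂ z) (collapse p v R t₂ z'))
    (d₂ := fun z z' => |max (min (proj p v z) (t₂ - R)) (t₁ + R) -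
        max (min (proj p v z') (t₂ - R)) (t₁ + R)| +
        dist (collapse p (-v) R (-t₁) z) (collapse p (-v) R (-t₁) z'))
    (fun _ _ _ => dist_triangle _ _ _) ?_
    (fun _ _ => dist_comm _ _) ?_ (dist_collapse_le hv R _) hstrip ?_ ?_ z z'
  · intro z z' z''
    have h1 := abs_sub_le (max (min (proj p v z) (t₂ - R)) (t₁ + R))
      (max (min (proj p v z') (t₂ - R)) (t₁ + R)) (max (min (proj p v z'') (t₂ - R)) (t₁ + R))
    have h2 := dist_triangle (collapse p (-v) R (-t₁) z) (collapse p (-v) R (-t₁) z')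
      (collapse p (-v) R (-t₁) z'')
    linarith
  · intro z z'
    rw [abs_sub_comm, dist_comm]
  · intro z z' h h'
    rw [collapse_of_le_sub hR h, collapse_of_le_sub hR h', dist_self]
  · intro z z' h h'
    rw [min_eq_right h, min_eq_right h', sub_self, abs_zero, zero_add,
      collapse_of_le_sub hR (by rw [proj_neg]; linarith),
      collapse_of_le_sub hR (by rw [proj_neg]; linarith), dist_self]

lemma perp_eq_zero_of_dim_one {p v : Pt 1} (hv : ‖v‖ = 1) (z : Pt 1) : perp p v z = 0 := by
  have hv2 : v 0 ^ 2 = 1 := by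
    have := EuclideanSpace.norm_sq_eq v
    rw [hv] at this
    simpa using this.symm
  ext i
  have hi : i = 0 := Subsingleton.elim _ _
  subst hi
  simp only [perp, proj, PiLp.sub_apply, PiLp.smul_apply, smul_eq_mul, PiLp.zero_apply,
    PiLp.inner_apply]
  simp
  linear_combination (p 0 - z 0) * hv2

end Geometry

lemma massOf_eq_linearCombination {m : ℕ} (b : Pt m →₀ ℝ) :
    massOf b = Finsupp.linearCombination ℝ (fun _ => (1 : ℝ)) b := by
  simp [massOf, Finsupp.linearCombination_apply]

lemma massOf_add {m : ℕ} (b c : Pt m →₀ ℝ) : massOf (b + c) = massOf b + massOf c := by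
  simp only [massOf_eq_linearCombination, map_add]

lemma massOf_nonneg {m : ℕ} {b : Pt m →₀ ℝ} (hb : 0 ≤ b) : 0 ≤ massOf b :=
  Finset.sum_nonneg fun z _ => hb z

lemma support_single_subset {m : ℕ} {X : Set (Pt m)} {u : Pt m} (hu : u ∈ X) (t : ℝ) :
    ↑(Finsupp.single u t).support ⊆ X := by
  intro z hz
  rw [Finset.mem_singleton.1 (Finsupp.support_single_subset hz)]
  exact hu

lemma support_add_subset {m : ℕ} {X : Set (Pt m)} {b c : Pt m →₀ ℝ} (hb : ↑b.support ⊆ X)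
    (hc : ↑c.support ⊆ X) : ↑(b + c).support ⊆ X := fun _ hz =>
  (Finset.mem_union.1 (Finsupp.support_add hz)).elim (fun h => hb h) (fun h => hc h)

lemma exists_transportPath_single {m : ℕ} {X : Set (Pt m)} (hX : IsCompact X)
    (hXc : Convex ℝ X) {u : Pt m} (hu : u ∈ X) {b : Pt m →₀ ℝ} (hb : 0 ≤ b)
    (hbX : ↑b.support ⊆ X) : ∃ G, IsTransportPath X G (Finsupp.single u (massOf b)) b := by
  have hdiv : WFlow.div (∑ z ∈ b.support, Finsupp.single (u, z) (b z)) =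
      Finsupp.single u (massOf b) - b := by
    rw [map_sum]
    simp only [WFlow.div_single]
    rw [Finset.sum_sub_distrib]
    congr 1
    · exact (map_sum (Finsupp.singleAddHom u) _ _).symm
    · exact Finsupp.sum_single b
  obtain ⟨G, hG, -⟩ := exists_transportPath_cost_le hX hXc ⟨u, hu⟩ le_rfl zero_le_one
    (Finset.sum_nonneg fun z _ => Finsupp.single_nonneg.2 (hb z))
    (support_single_subset hu _) hbX hdiv
  exact ⟨G, hG⟩

lemma dist_axis_le {m : ℕ} {p v : Pt m} (hv : ‖v‖ = 1) {R t : ℝ} {w : Pt m}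
    (hw : proj p v w ≤ t) (hwR : ‖perp p v w‖ ≤ R) :
    dist w (p + t • v) ≤ t - proj p v w + R := by
  have h : w - (p + t • v) = (proj p v w - t) • v + perp p v w := by
    simp only [perp, sub_smul]
    abel
  rw [dist_eq_norm, h]
  refine (norm_add_le _ _).trans (add_le_add ?_ hwR)
  rw [norm_smul, hv, mul_one, Real.norm_eq_abs, abs_sub_comm, abs_of_nonneg (by linarith)]

lemma mapDomain_eq_self {m : ℕ} {F : Pt m → Pt m} {b : Pt m →₀ ℝ}
    (h : ∀ z ∈ b.support, F z = z) : b.mapDomain F = b := by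
  conv_rhs => rw [← Finsupp.mapDomain_id (v := b)]
  exact Finsupp.mapDomain_congr h

/-- In a circulation-free flow from a single source, part `b₁` of the demand is served by a
subflow none of whose edges carries more than the mass of `b₁`. -/
lemma WFlow.CirculationFree.exists_subflow {m : ℕ} {f : WFlow m} (hf : 0 ≤ f)
    (hcf : f.CirculationFree) {u : Pt m} {b₁ b₂ : Pt m →₀ ℝ} (h₁ : 0 ≤ b₁) (h₂ : 0 ≤ b₂)
    (hdiv : WFlow.div f = Finsupp.single u (massOf b₁ + massOf b₂) - (b₁ + b₂)) :
    ∃ g : WFlow m, 0 ≤ g ∧ g ≤ f ∧ (∀ e, g e ≤ massOf b₁) ∧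
      WFlow.div g = Finsupp.single u (massOf b₁) - b₁ := by
  obtain ⟨h, g, hg, hgf, hgd⟩ := WFlow.exists_subflow hf h₁ h₂ hdiv
  have hgd' : WFlow.div g =
      Finsupp.single u (h u * (massOf b₁ + massOf b₂)) - b₁ := by
    ext z
    rw [hgd, Finsupp.sub_apply, Finsupp.single_apply, Finsupp.single_apply]
    split_ifs with hz
    · rw [hz]
    · rw [mul_zero]
  have hmass : h u * (massOf b₁ + massOf b₂) = massOf b₁ := by
    have := WFlow.linearCombination_div (fun _ => (1 : ℝ)) (subset_rfl : g.support ⊆ g.support)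
    rw [hgd', map_sub, Finsupp.linearCombination_single, ← massOf_eq_linearCombination] at this
    simp only [sub_self, mul_zero, Finset.sum_const_zero, smul_eq_mul, mul_one] at this
    linarith
  rw [hmass] at hgd'
  refine ⟨g, hg, hgf, hcf.le_mass hg ?_ (massOf_nonneg h₁) h₁ hgd'
    (massOf_eq_linearCombination b₁).symm, hgd'⟩
  intro e he
  rw [Finsupp.mem_support_iff] at he ⊢
  have h1 := hg e
  have h2 := hgf e
  exact (((lt_of_le_of_ne h1 he.symm)).trans_le h2).ne'

/-- Carrying demand `b` across a strip of width `s₂ - s₁` costs at least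
`massOf b ^ α * (s₂ - s₁)` inside the strip. -/
lemma rpow_mul_le_sum_massCost {m : ℕ} {α : ℝ} (hα : 0 ≤ α) (hα1 : α ≤ 1) {f g : WFlow m}
    (hg : 0 ≤ g) (hgf : g ≤ f) {u : Pt m} {b : Pt m →₀ ℝ} (hM : 0 < massOf b)
    (hgM : ∀ e, g e ≤ massOf b) (hdiv : WFlow.div g = Finsupp.single u (massOf b) - b)
    {κ : Pt m → ℝ} {s₁ s₂ : ℝ} (hu : κ u = s₂) (hb : ∀ z ∈ b.support, κ z = s₁)
    {T : Finset (Pt m × Pt m)} (hT : g.support ⊆ T) :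
    massOf b ^ α * (s₂ - s₁) ≤ ∑ e ∈ T, massCost α (f e) * |κ e.1 - κ e.2| := by
  have hb' : Finsupp.linearCombination ℝ κ b = massOf b * s₁ := by
    rw [Finsupp.linearCombination_apply, massOf, Finsupp.sum, Finsupp.sum, Finset.sum_mul]
    exact Finset.sum_congr rfl fun z hz => by rw [hb z hz, smul_eq_mul]
  have hsum := WFlow.linearCombination_div κ hT
  rw [hdiv, map_sub, Finsupp.linearCombination_single, hb', hu, smul_eq_mul] at hsum
  have hpow : massOf b ^ α = massOf b ^ (α - 1) * massOf b := by
    rw [Real.rpow_sub_one hM.ne', div_mul_cancel₀ _ hM.ne']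
  rw [hpow, mul_assoc, mul_sub, hsum, Finset.mul_sum]
  refine Finset.sum_le_sum fun e _ => ?_
  have h1 := mul_rpow_sub_one_le_massCost hα1 (hg e) (hgM e)
  have h2 := massCost_mono hα (hg e) (hgf e)
  have h3 : 0 ≤ massOf b ^ (α - 1) * g e := mul_nonneg (Real.rpow_nonneg hM.le _) (hg e)
  rw [← mul_assoc]
  refine (mul_le_mul_of_nonneg_left (le_abs_self _) h3).trans ?_
  exact mul_le_mul_of_nonneg_right (by linarith) (abs_nonneg _)

/-- Handing the demand `bL` on the far side of the gap over from `u` to `w` saves at least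
the crossing cost, up to the cost of connecting `w` to the axis. -/
lemma dCost_reassign_le {m : ℕ} {X : Set (Pt m)} (hX : IsCompact X) (hXc : Convex ℝ X)
    {α : ℝ} (hα : 0 ≤ α) (hα1 : α ≤ 1) {p v : Pt m} (hv : ‖v‖ = 1) {R t₁ t₂ : ℝ} (hR : 0 ≤ R)
    (ht : t₁ + R ≤ t₂ - R) {u w : Pt m} (huX : u ∈ X) (hwX : w ∈ X)
    (huR : ‖perp p v u‖ ≤ R) (hwR : ‖perp p v w‖ ≤ R)
    (hut : t₂ ≤ proj p v u) (hwt : proj p v w ≤ t₁) {bL bR b : Pt m →₀ ℝ}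
    (hL : 0 ≤ bL) (hR' : 0 ≤ bR) (hb : 0 ≤ b) (hLX : ↑bL.support ⊆ X) (hRX : ↑bR.support ⊆ X)
    (hbX : ↑b.support ⊆ X) (hM : 0 < massOf bL)
    (hLt : ∀ z ∈ bL.support, proj p v z ≤ t₁ ∧ ‖perp p v z‖ ≤ R)
    (hRt : ∀ z ∈ bR.support, t₂ ≤ proj p v z ∧ ‖perp p v z‖ ≤ R) :
    dCost X α (Finsupp.single u (massOf bR)) bR +
      dCost X α (Finsupp.single w (massOf (b + bL))) (b + bL) +
      massOf bL ^ α * ((t₂ - R - (t₁ + R)) - (t₁ - proj p v w + R)) ≤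
    dCost X α (Finsupp.single u (massOf (bL + bR))) (bL + bR) +
      dCost X α (Finsupp.single w (massOf b)) b := by
  refine le_of_forall_pos_le_add fun ε hε => ?_
  obtain ⟨f, hf, hfd, hfc, hcf⟩ := exists_flow_fcost_lt hα hα1
    (exists_transportPath_single hX hXc huX (add_nonneg hL hR') (support_add_subset hLX hRX))
    (lt_add_of_pos_right (dCost X α _ _) (half_pos hε))
  obtain ⟨f', hf', hfd', hfc', -⟩ := exists_flow_fcost_lt hα hα1
    (exists_transportPath_single hX hXc hwX hb hbX)
    (lt_add_of_pos_right (dCost X α _ _) (half_pos hε))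
  rw [massOf_add] at hfd
  obtain ⟨g, hg, hgf, hgM, hgd⟩ := hcf.exists_subflow hf hL hR' hfd
  have hgT : g.support ⊆ f.support := by
    intro e he
    rw [Finsupp.mem_support_iff] at he ⊢
    exact ((lt_of_le_of_ne (hg e) he.symm).trans_le (hgf e)).ne'
  have hfg : 0 ≤ f - g := fun e => sub_nonneg.2 (hgf e)
  have hfgT : (f - g).support ⊆ f.support :=
    Finsupp.support_sub.trans (Finset.union_subset subset_rfl hgT)
  set dR : Pt m → Pt m → ℝ := fun z z' =>
    dist (collapse p v R t₂ z) (collapse p v R t₂ z') with hdR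
  set dL : Pt m → Pt m → ℝ := fun z z' =>
    dist (collapse p (-v) R (-t₁) z) (collapse p (-v) R (-t₁) z') with hdL
  set κ : Pt m → ℝ := fun z => max (min (proj p v z) (t₂ - R)) (t₁ + R) with hκ
  have c₁ : dCost X α (Finsupp.single u (massOf bR)) bR ≤
      ∑ e ∈ f.support, massCost α (f e) * dR e.1 e.2 := by
    refine (dCost_le_fcost hX hXc ⟨u, huX⟩ hα hα1
      (WFlow.push_nonneg (collapse p v R t₂) hfg) (support_single_subset huX _) hRX ?_).trans
      ((WFlow.fcost_push_le hα hα1 _ hfg hfgT).trans ?_)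
    · have hd : WFlow.div (f - g) = Finsupp.single u (massOf bR) - bR := by
        rw [map_sub, hfd, hgd, Finsupp.single_add]
        abel
      rw [WFlow.div_push, hd, Finsupp.mapDomain_sub, Finsupp.mapDomain_single,
        collapse_of_le hut huR,
        mapDomain_eq_self fun z hz => collapse_of_le (hRt z hz).1 (hRt z hz).2]
    · refine Finset.sum_le_sum fun e _ => mul_le_mul_of_nonneg_right ?_ dist_nonneg
      exact massCost_mono hα (hfg e) (sub_le_self _ (hg e))
  have c₂ : dCost X α (Finsupp.single w (massOf (b + bL))) (b + bL) ≤
      WFlow.fcost α f' + (massOf bL ^ α * (t₁ - proj p v w + R) +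
        ∑ e ∈ f.support, massCost α (f e) * dL e.1 e.2) := by
    have hs : 0 ≤ Finsupp.single (w, p + t₁ • v) (massOf bL) := Finsupp.single_nonneg.2 hM.le
    have hp := WFlow.push_nonneg (collapse p (-v) R (-t₁)) hg
    refine (dCost_le_fcost hX hXc ⟨u, huX⟩ hα hα1 (add_nonneg hf' (add_nonneg hs hp))
      (support_single_subset hwX _) (support_add_subset hbX hLX) ?_).trans
      ((WFlow.fcost_add_le hα hα1 hf' (add_nonneg hs hp)).trans
        (add_le_add le_rfl ((WFlow.fcost_add_le hα hα1 hs hp).trans (add_le_add ?_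
          ((WFlow.fcost_push_le hα hα1 _ hg hgT).trans ?_)))))
    · have hu : collapse p (-v) R (-t₁) u = p + t₁ • v := by
        rw [collapse_of_le_sub hR (by rw [proj_neg]; linarith), neg_smul_neg]
      rw [map_add, map_add, WFlow.div_single, WFlow.div_push, hfd', hgd, Finsupp.mapDomain_sub,
        Finsupp.mapDomain_single, hu, mapDomain_eq_self fun z hz => collapse_of_le
          (by rw [proj_neg]; exact neg_le_neg (hLt z hz).1) (by rw [perp_neg]; exact (hLt z hz).2),
        massOf_add, Finsupp.single_add]
      abel
    · rw [WFlow.fcost_single, massCost_of_pos α hM]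
      exact mul_le_mul_of_nonneg_left (dist_axis_le hv hwt hwR) (Real.rpow_nonneg hM.le _)
    · refine Finset.sum_le_sum fun e _ => mul_le_mul_of_nonneg_right ?_ dist_nonneg
      exact massCost_mono hα (hg e) (hgf e)
  have c₃ := rpow_mul_le_sum_massCost hα hα1 hg hgf hM hgM hgd (κ := κ) (s₁ := t₁ + R)
    (s₂ := t₂ - R) (by rw [hκ]; dsimp only; rw [min_eq_right (by linarith), max_eq_left ht])
    (fun z hz => max_eq_right ((min_le_left _ _).trans (by linarith [(hLt z hz).1]))) hgT
  have c₄ : ∑ e ∈ f.support, massCost α (f e) * dR e.1 e.2 +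
      (∑ e ∈ f.support, massCost α (f e) * |κ e.1 - κ e.2| +
      ∑ e ∈ f.support, massCost α (f e) * dL e.1 e.2) ≤ WFlow.fcost α f := by
    rw [WFlow.fcost_eq_sum α subset_rfl, ← Finset.sum_add_distrib, ← Finset.sum_add_distrib]
    refine Finset.sum_le_sum fun e _ => ?_
    rw [← mul_add, ← mul_add]
    exact mul_le_mul_of_nonneg_left (dist_collapse_add_le hv hR ht _ _)
      (massCost_nonneg α (hf e))
  linarith

lemma mB_eq_massOf {m k ℓ : ℕ} (y : Fin ℓ → Pt m) (n : Fin ℓ → ℝ) (S : Fin ℓ → Fin k)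
    (i : Fin k) : mB n S i = massOf (bPart y n S i) := by
  simp [massOf_eq_linearCombination, mB, bPart, map_sum]

lemma sum_single_nonneg {m ℓ : ℕ} (y : Fin ℓ → Pt m) {n : Fin ℓ → ℝ} (hn : ∀ j, 0 < n j)
    (D : Finset (Fin ℓ)) : 0 ≤ ∑ j ∈ D, Finsupp.single (y j) (n j) :=
  Finset.sum_nonneg fun j _ => Finsupp.single_nonneg.2 (hn j).le

lemma exists_of_mem_support_sum_single {m ℓ : ℕ} {y : Fin ℓ → Pt m} {n : Fin ℓ → ℝ}
    {D : Finset (Fin ℓ)} {z : Pt m}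
    (hz : z ∈ (∑ j ∈ D, Finsupp.single (y j) (n j)).support) : ∃ j ∈ D, y j = z := by
  obtain ⟨j, hj, hzj⟩ := Finset.mem_biUnion.1 (Finsupp.support_finsetSum hz)
  exact ⟨j, hj, (Finset.mem_singleton.1 (Finsupp.support_single_subset hzj)).symm⟩

/-- Under an optimal assignment map no household on the left of the gap is served from the
right of the gap, provided some factory lies close to the left end of the gap. -/
lemma IsOptimalAssign.proj_le {m k ℓ : ℕ} {X : Set (Pt m)} (hX : IsCompact X)
    (hXc : Convex ℝ X) {α : ℝ} (hα : 0 ≤ α) (hα1 : α ≤ 1) {x : Fin k → Pt m}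
    (hxX : ∀ i, x i ∈ X) {y : Fin ℓ → Pt m} (hyX : ∀ j, y j ∈ X) {n : Fin ℓ → ℝ}
    (hn : ∀ j, 0 < n j) {p v : Pt m} (hv : ‖v‖ = 1) {R t₁ t₂ σ : ℝ} (hR : 0 ≤ R)
    (hxR : ∀ i, ‖perp p v (x i)‖ ≤ R) (hyR : ∀ j, ‖perp p v (y j)‖ ≤ R) (hσ : 0 < σ)
    (ht : 3 * R + σ ≤ t₂ - t₁) (hgapx : ∀ i, proj p v (x i) ∉ Set.Ioo t₁ t₂)
    (hgapy : ∀ j, proj p v (y j) ∉ Set.Ioo t₁ t₂)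
    (hleft : ∃ i, proj p v (x i) ∈ Set.Ioc (t₁ - σ) t₁) {S : Fin ℓ → Fin k}
    (hS : IsOptimalAssign X α x y n S) {j : Fin ℓ} (hj : proj p v (y j) ≤ t₁) :
    proj p v (x (S j)) ≤ t₁ := by
  by_contra! hx
  have hx₂ : t₂ ≤ proj p v (x (S j)) := not_lt.1 fun h => hgapx _ ⟨hx, h⟩
  obtain ⟨i', hi'σ, hi't⟩ := hleft
  set i := S j with hi
  have hii' : i ≠ i' := by
    rintro h
    rw [← h] at hi't
    linarith
  set S' : Fin ℓ → Fin k := fun j => if S j = i ∧ proj p v (y j) ≤ t₁ then i' else S j with hS'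
  set bL : Pt m →₀ ℝ := ∑ j with S j = i ∧ proj p v (y j) ≤ t₁, Finsupp.single (y j) (n j) with hbL
  set bR : Pt m →₀ ℝ := ∑ j with S j = i ∧ ¬ proj p v (y j) ≤ t₁, Finsupp.single (y j) (n j) with hbR
  have hSi : bPart y n S i = bL + bR := by
    rw [bPart, hbL, hbR, ← Finset.sum_filter_add_sum_filter_not _ (fun j => proj p v (y j) ≤ t₁),
      Finset.filter_filter, Finset.filter_filter]
  have hS'i : bPart y n S' i = bR := by
    rw [bPart, hbR]
    refine Finset.sum_congr (Finset.filter_congr fun j _ => ?_) fun _ _ => rfl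
    simp only [hS']
    split_ifs with h
    · exact ⟨fun h' => absurd h'.symm hii', fun h' => absurd h.2 h'.2⟩
    · exact ⟨fun h' => ⟨h', fun h'' => h ⟨h', h''⟩⟩, fun h' => h'.1⟩
  have hS'i' : bPart y n S' i' = bPart y n S i' + bL := by
    rw [bPart, bPart, hbL, ← Finset.sum_union]
    · refine Finset.sum_congr ?_ fun _ _ => rfl
      ext j
      simp only [hS', Finset.mem_filter, Finset.mem_union, Finset.mem_univ, true_and]
      split_ifs with h
      · exact ⟨fun _ => Or.inr h, fun _ => rfl⟩
      · exact ⟨Or.inl, fun h' => h'.resolve_right h⟩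
    · rw [Finset.disjoint_filter]
      exact fun j _ h h' => hii' (h'.1.symm.trans h)
  have hS'o : ∀ o, o ≠ i ∧ o ≠ i' → bPart y n S' o = bPart y n S o := by
    intro o ho
    rw [bPart, bPart]
    refine Finset.sum_congr (Finset.filter_congr fun j _ => ?_) fun _ _ => rfl
    simp only [hS']
    split_ifs with h
    · exact ⟨fun h' => absurd h'.symm ho.2, fun h' => absurd (h'.symm.trans h.1) ho.1⟩
    · exact Iff.rfl
  have hsupp : ∀ D : Finset (Fin ℓ),
      ↑(∑ j ∈ D, Finsupp.single (y j) (n j)).support ⊆ X := by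
    intro D z hz
    obtain ⟨j, -, rfl⟩ := exists_of_mem_support_sum_single hz
    exact hyX j
  have hM : 0 < massOf bL := by
    rw [massOf_eq_linearCombination, hbL, map_sum]
    simp only [Finsupp.linearCombination_single, smul_eq_mul, mul_one]
    exact Finset.sum_pos (fun j _ => hn j)
      ⟨j, Finset.mem_filter.2 ⟨Finset.mem_univ _, hi.symm, hj⟩⟩
  have key := dCost_reassign_le hX hXc hα hα1 hv hR (by linarith) (hxX i) (hxX i')
    (hxR i) (hxR i') hx₂ hi't (bL := bL) (bR := bR) (b := bPart y n S i')
    (sum_single_nonneg y hn _) (sum_single_nonneg y hn _) (sum_single_nonneg y hn _)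
    (hsupp _) (hsupp _) (hsupp _) hM
    (by
      intro z hz
      obtain ⟨j, hj, rfl⟩ := exists_of_mem_support_sum_single hz
      exact ⟨(Finset.mem_filter.1 hj).2.2, hyR j⟩)
    (by
      intro z hz
      obtain ⟨j, hj, rfl⟩ := exists_of_mem_support_sum_single hz
      have h := (Finset.mem_filter.1 hj).2.2
      exact ⟨not_lt.1 fun h' => hgapy j ⟨not_le.1 h, h'⟩, hyR j⟩)
  have hdiff : Ealpha X α x y n S' - Ealpha X α x y n S =
      (dCost X α (Finsupp.single (x i) (massOf bR)) bR -
        dCost X α (Finsupp.single (x i) (massOf (bL + bR))) (bL + bR)) +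
      (dCost X α (Finsupp.single (x i') (massOf (bPart y n S i' + bL))) (bPart y n S i' + bL) -
        dCost X α (Finsupp.single (x i') (massOf (bPart y n S i'))) (bPart y n S i')) := by
    rw [Ealpha, Ealpha, ← Finset.sum_sub_distrib, Fintype.sum_eq_add i i' hii']
    · simp only [mB_eq_massOf y, hSi, hS'i, hS'i']
    · intro o ho
      simp only [mB_eq_massOf y, hS'o o ho, sub_self]
  have hpos : 0 < massOf bL ^ α * ((t₂ - R - (t₁ + R)) - (t₁ - proj p v (x i') + R)) :=
    mul_pos (Real.rpow_pos_of_pos hM α) (by linarith)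
  have := hS S'
  linarith

lemma two_le_Cconst {m : ℕ} (hm : 2 ≤ m) {α : ℝ} (hα1 : α < 1)
    (hmα : ((m : ℝ) - 1) * (1 - α) < 1) : 2 ≤ Cconst m α := by
  have hm' : (2 : ℝ) ≤ m := by exact_mod_cast hm
  have hs : 1 ≤ Real.sqrt ((m : ℝ) - 1) := Real.one_le_sqrt.2 (by linarith)
  have hprod : 0 ≤ ((m : ℝ) - 1) * (1 - α) := mul_nonneg (by linarith) (by linarith)
  have h1 : (1 : ℝ) < 2 ^ (1 - ((m : ℝ) - 1) * (1 - α)) :=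
    Real.one_lt_rpow one_lt_two (by linarith)
  have h2 : (2 : ℝ) ^ (1 - ((m : ℝ) - 1) * (1 - α)) ≤ 2 := by
    conv_rhs => rw [← Real.rpow_one 2]
    exact Real.rpow_le_rpow_of_exponent_le one_le_two (by linarith)
  have h3 : 1 ≤ Real.sqrt ((m : ℝ) - 1) / ((2 : ℝ) ^ (1 - ((m : ℝ) - 1) * (1 - α)) - 1) :=
    (one_le_div (by linarith)).2 (by linarith)
  rw [Cconst]
  linarith

/-- ("Autarky") If no projected factory or household lies in
`(t₁, t₂)` with `t₂ = t₁ + 2 C R + σ`, while some factory projects into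
`(t₁ − σ, t₁]` and some into `[t₂, t₂ + σ)`, then under any optimal assignment
map each household is assigned within its own side. -/
theorem stmt_17 {m k ℓ : ℕ} (X : Set (Pt m)) (hXc : IsCompact X) (hXconv : Convex ℝ X)
    (α : ℝ) (hα0 : 0 ≤ α) (hα1 : α < 1)
    (x : Fin k → Pt m) (hxinj : Function.Injective x) (hxX : ∀ i, x i ∈ X)
    (y : Fin ℓ → Pt m) (hyinj : Function.Injective y) (hyX : ∀ j, y j ∈ X)
    (n : Fin ℓ → ℝ) (hn : ∀ j, 0 < n j) (hnsum : ∑ j, n j = 1)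
    (p v : Pt m) (hv : ‖v‖ = 1) (hmα : ((m : ℝ) - 1) * (1 - α) < 1)
    (hk : 2 ≤ k)
    (R : ℝ)
    (hR : IsGreatest ((fun z : Pt m => ‖z - p - proj p v z • v‖) ''
        (Set.range y ∪ Set.range x)) R)
    (t₁ t₂ σ : ℝ) (hσ : 0 < σ) (ht₂ : t₂ = t₁ + 2 * Cconst m α * R + σ)
    (hgapx : ∀ i : Fin k, proj p v (x i) ∉ Set.Ioo t₁ t₂)
    (hgapy : ∀ j : Fin ℓ, proj p v (y j) ∉ Set.Ioo t₁ t₂)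
    (hleft : ∃ i : Fin k, proj p v (x i) ∈ Set.Ioc (t₁ - σ) t₁)
    (hright : ∃ i : Fin k, proj p v (x i) ∈ Set.Ico t₂ (t₂ + σ)) :
    ∀ S : Fin ℓ → Fin k, IsOptimalAssign X α x y n S → ∀ j : Fin ℓ,
      (proj p v (y j) ≤ t₁ ↔ proj p v (x (S j)) ≤ t₁) ∧
      (t₂ ≤ proj p v (y j) ↔ t₂ ≤ proj p v (x (S j))) := by
  intro S hS j
  have hxR : ∀ i, ‖perp p v (x i)‖ ≤ R := fun i => hR.2 ⟨x i, Or.inr ⟨i, rfl⟩, rfl⟩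
  have hyR : ∀ j, ‖perp p v (y j)‖ ≤ R := fun j => hR.2 ⟨y j, Or.inl ⟨j, rfl⟩, rfl⟩
  have hR0 : 0 ≤ R := (norm_nonneg _).trans (hyR j)
  have hwidth : 3 * R + σ ≤ t₂ - t₁ := by
    rcases Nat.lt_or_ge m 2 with hm | hm
    · interval_cases m
      · rw [Subsingleton.elim v 0, norm_zero] at hv
        norm_num at hv
      · obtain ⟨z, -, hz⟩ := hR.1
        have hz0 : ‖perp p v z‖ = 0 := by rw [perp_eq_zero_of_dim_one hv, norm_zero]
        have hR1 : R = 0 := hz.symm.trans hz0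
        rw [ht₂, hR1]
        linarith
    · have := mul_le_mul_of_nonneg_right (two_le_Cconst hm hα1 hmα) hR0
      rw [ht₂]
      linarith
  have hl : proj p v (y j) ≤ t₁ → proj p v (x (S j)) ≤ t₁ :=
    hS.proj_le hXc hXconv hα0 hα1.le hxX hyX hn hv hR0 hxR hyR hσ hwidth hgapx hgapy hleft
  have hr : t₂ ≤ proj p v (y j) → t₂ ≤ proj p v (x (S j)) := by
    intro h
    have hneg := hS.proj_le hXc hXconv hα0 hα1.le hxX hyX hn (p := p) (v := -v)
      (by rwa [norm_neg]) hR0 (fun i => by rw [perp_neg]; exact hxR i)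
      (fun i => by rw [perp_neg]; exact hyR i) hσ (t₁ := -t₂) (t₂ := -t₁) (by linarith)
      (fun i hi => by
        rw [proj_neg] at hi
        exact hgapx i ⟨neg_lt_neg_iff.1 hi.2, neg_lt_neg_iff.1 hi.1⟩)
      (fun i hi => by
        rw [proj_neg] at hi
        exact hgapy i ⟨neg_lt_neg_iff.1 hi.2, neg_lt_neg_iff.1 hi.1⟩)
      (by
        obtain ⟨i, hi, hi'⟩ := hright
        refine ⟨i, ?_, ?_⟩ <;> rw [proj_neg] <;> linarith)
      (j := j) (by rw [proj_neg]; linarith)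
    rw [proj_neg] at hneg
    linarith
  have hy := hgapy j
  simp only [Set.mem_Ioo, not_and, not_lt] at hy
  refine ⟨⟨hl, fun h => ?_⟩, hr, fun h => ?_⟩
  · by_contra! h'
    linarith [hr (hy h')]
  · by_contra! h'
    have h'' : proj p v (y j) ≤ t₁ := not_lt.1 fun h'' => h'.not_ge (hy h'')
    linarith [hl h'']

end
end

section
/- Suppose k ≥ 2, S is an optimal assignment map, and U = (u_{sh}) is a state matrix for S. Let j ∈ {1,…,ℓ} and s ∈ {1,…,k}. (i) If w_s(U) ≥ n_j and min_{i≠s} ‖y_j − x_i‖ < ρ_α(w_s(U), n_j)·‖y_j − x_s‖, then S(j) ≠ s. (ii) If for every i ≠ s with w_i(U) ≥ n_j one has ‖y_j − x_s‖ < ρ_α(w_i(U), n_j)·‖y_j − x_i‖, then S(j) = s. -/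
open scoped BigOperators RealInnerProductSpace

noncomputable section

attribute [local instance] Classical.propDecidable

/-! ### The cost of transporting a signed amount along a unit length -/

/-- The cost `|t|^α` of carrying the signed amount `t` over a unit length, with the convention
that carrying nothing is free (also for `α = 0`). -/
def edgeCost (α t : ℝ) : ℝ := if t = 0 then 0 else |t| ^ α

section EdgeCost

variable {α : ℝ}

lemma edgeCost_zero : edgeCost α 0 = 0 := by simp [edgeCost]

lemma edgeCost_of_pos {t : ℝ} (ht : 0 < t) : edgeCost α t = t ^ α := by
  rw [edgeCost, if_neg ht.ne', abs_of_pos ht]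

lemma edgeCost_neg (t : ℝ) : edgeCost α (-t) = edgeCost α t := by
  simp [edgeCost]

lemma edgeCost_abs (t : ℝ) : edgeCost α |t| = edgeCost α t := by
  simp [edgeCost]

lemma edgeCost_nonneg (t : ℝ) : 0 ≤ edgeCost α t := by
  unfold edgeCost
  split_ifs <;> positivity

lemma edgeCost_mono_abs (hα0 : 0 ≤ α) {s t : ℝ} (h : |s| ≤ |t|) :
    edgeCost α s ≤ edgeCost α t := by
  by_cases hs : s = 0
  · rw [hs, edgeCost_zero]
    exact edgeCost_nonneg t
  · have ht : t ≠ 0 := by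
      rintro rfl
      exact hs (by simpa using h)
    rw [edgeCost, edgeCost, if_neg hs, if_neg ht]
    exact Real.rpow_le_rpow (abs_nonneg s) h hα0

lemma concaveOn_edgeCost (hα0 : 0 ≤ α) (hα1 : α ≤ 1) :
    ConcaveOn ℝ (Set.Ici 0) (edgeCost α) := by
  rcases hα0.eq_or_lt with rfl | hα
  · refine ⟨convex_Ici 0, fun a ha b hb p q hp hq hpq => ?_⟩
    have ha' : (0 : ℝ) ≤ a := ha
    have hb' : (0 : ℝ) ≤ b := hb
    simp only [edgeCost, Real.rpow_zero, smul_eq_mul]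
    by_cases h : p * a + q * b = 0
    · have h1 : p * a = 0 := by nlinarith [mul_nonneg hp ha', mul_nonneg hq hb']
      have h2 : q * b = 0 := by nlinarith [mul_nonneg hp ha', mul_nonneg hq hb']
      rw [if_pos h]
      rcases mul_eq_zero.1 h1 with h1 | h1 <;> rcases mul_eq_zero.1 h2 with h2 | h2 <;>
        simp [h1, h2]
    · rw [if_neg h]
      split_ifs <;> linarith
  · refine (Real.concaveOn_rpow hα0 hα1).congr fun t ht => ?_
    rcases (show (0 : ℝ) ≤ t from ht).eq_or_lt with rfl | ht'
    · simp [edgeCost_zero, Real.zero_rpow hα.ne']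
    · exact (edgeCost_of_pos ht').symm

/-- The increments of the edge cost over intervals of fixed length decrease. -/
lemma edgeCost_increment (hα0 : 0 ≤ α) (hα1 : α ≤ 1) {a b t : ℝ} (ha : 0 ≤ a) (hab : a ≤ b)
    (ht : 0 ≤ t) :
    edgeCost α (b + t) - edgeCost α b ≤ edgeCost α (a + t) - edgeCost α a := by
  rcases ht.eq_or_lt with rfl | ht'
  · simp
  have hD : 0 < b + t - a := by linarith
  have hC := (concaveOn_edgeCost hα0 hα1).2
  have h1 := hC (show a ∈ Set.Ici (0 : ℝ) from ha)
    (show b + t ∈ Set.Ici (0 : ℝ) from by simp only [Set.mem_Ici]; linarith)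
    (show 0 ≤ (b - a) / (b + t - a) from div_nonneg (by linarith) hD.le)
    (show 0 ≤ t / (b + t - a) by positivity) (by field_simp; ring)
  have h2 := hC (show a ∈ Set.Ici (0 : ℝ) from ha)
    (show b + t ∈ Set.Ici (0 : ℝ) from by simp only [Set.mem_Ici]; linarith)
    (show 0 ≤ t / (b + t - a) by positivity)
    (show 0 ≤ (b - a) / (b + t - a) from div_nonneg (by linarith) hD.le) (by field_simp; ring)
  simp only [smul_eq_mul] at h1 h2
  have e1 : (b - a) / (b + t - a) * a + t / (b + t - a) * (b + t) = a + t := by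
    field_simp; ring
  have e2 : t / (b + t - a) * a + (b - a) / (b + t - a) * (b + t) = b := by
    field_simp; ring
  rw [e1] at h1
  rw [e2] at h2
  have e3 : (b - a) / (b + t - a) + t / (b + t - a) = 1 := by field_simp; ring
  have e4 : (b - a) / (b + t - a) = 1 - t / (b + t - a) := by linarith
  rw [e4] at h1 h2
  linarith

lemma edgeCost_add_le (hα0 : 0 ≤ α) (hα1 : α ≤ 1) (s t : ℝ) :
    edgeCost α (s + t) ≤ edgeCost α s + edgeCost α t := by
  have h1 : edgeCost α (s + t) ≤ edgeCost α (|s| + |t|) :=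
    edgeCost_mono_abs hα0 ((abs_add_le s t).trans (le_abs_self _))
  have h2 := edgeCost_increment hα0 hα1 le_rfl (abs_nonneg s) (abs_nonneg t)
  rw [zero_add, edgeCost_zero, edgeCost_abs, edgeCost_abs] at h2
  linarith

/-- Concavity of the edge cost along a segment on which the sign does not change. -/
lemma edgeCost_concave_of_same_sign (hα0 : 0 ≤ α) (hα1 : α ≤ 1) {z c s t : ℝ} (hs : 0 < s)
    (ht : 0 < t) (hz : z = 0 → c = 0) (h1 : 0 ≤ z * (z - s * c)) (h2 : 0 ≤ z * (z + t * c)) :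
    t * edgeCost α (z - s * c) + s * edgeCost α (z + t * c) ≤ (s + t) * edgeCost α z := by
  have key : ∀ z c : ℝ, 0 ≤ z - s * c → 0 ≤ z + t * c →
      t * edgeCost α (z - s * c) + s * edgeCost α (z + t * c) ≤ (s + t) * edgeCost α z := by
    intro z c h1 h2
    have h := (concaveOn_edgeCost hα0 hα1).2 (show _ ∈ Set.Ici (0 : ℝ) from h1)
      (show _ ∈ Set.Ici (0 : ℝ) from h2) (show 0 ≤ t / (s + t) by positivity)
      (show 0 ≤ s / (s + t) by positivity) (by field_simp; ring)
    simp only [smul_eq_mul] at h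
    have e : t / (s + t) * (z - s * c) + s / (s + t) * (z + t * c) = z := by
      field_simp; ring
    rw [e] at h
    have h' := mul_le_mul_of_nonneg_left h (show 0 ≤ s + t by positivity)
    have e' : (s + t) * (t / (s + t) * edgeCost α (z - s * c)
        + s / (s + t) * edgeCost α (z + t * c))
        = t * edgeCost α (z - s * c) + s * edgeCost α (z + t * c) := by
      field_simp
    linarith
  rcases lt_trichotomy z 0 with h | h | h
  · have h3 := key (-z) (-c) (by nlinarith) (by nlinarith)
    have e1 : -z - s * -c = -(z - s * c) := by ring
    have e2 : -z + t * -c = -(z + t * c) := by ring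
    rwa [e1, e2, edgeCost_neg, edgeCost_neg, edgeCost_neg] at h3
  · simp [h, hz h, edgeCost_zero]
  · exact key z c (by nlinarith) (by nlinarith)

end EdgeCost

/-! ### Signed flows -/

/-- `f` is an antisymmetric flow carried by `V` whose net outflow at `u` is `c u`. -/
structure IsFlow {P : Type*} (V : Finset P) (f : P → P → ℝ) (c : P →₀ ℝ) : Prop where
  antisymm : ∀ u v, f u v = -f v u
  mem : ∀ u v, f u v ≠ 0 → u ∈ V
  div : ∀ u, ∑ v ∈ V, f u v = c u

/-- The graph of all pairs across which the flow `f` is nonzero. -/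
def flowGraph {P : Type*} (f : P → P → ℝ) : SimpleGraph P :=
  SimpleGraph.fromRel fun u v => f u v ≠ 0

/-- The cost of a flow, every edge being counted in both directions. -/
def flowCost {P : Type*} [PseudoMetricSpace P] (α : ℝ) (V : Finset P) (f : P → P → ℝ) : ℝ :=
  ∑ u ∈ V, ∑ v ∈ V, edgeCost α (f u v) * dist u v

namespace IsFlow

variable {P : Type*} {V : Finset P} {f g : P → P → ℝ} {c d : P →₀ ℝ}

lemma self_eq_zero (hf : IsFlow V f c) (u : P) : f u u = 0 := by
  linarith [hf.antisymm u u]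

lemma mem_right (hf : IsFlow V f c) (u v : P) (h : f u v ≠ 0) : v ∈ V :=
  hf.mem v u fun h' => h (by rw [hf.antisymm, h', neg_zero])

lemma adj_iff (hf : IsFlow V f c) {u v : P} : (flowGraph f).Adj u v ↔ f u v ≠ 0 := by
  rw [flowGraph, SimpleGraph.fromRel_adj]
  constructor
  · rintro ⟨-, h | h⟩
    · exact h
    · rw [hf.antisymm]
      exact neg_ne_zero.2 h
  · intro h
    refine ⟨?_, Or.inl h⟩
    rintro rfl
    exact h (hf.self_eq_zero u)

lemma add_smul (hf : IsFlow V f c) (hg : IsFlow V g d) (t : ℝ) :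
    IsFlow V (fun u v => f u v + t * g u v) (c + t • d) where
  antisymm u v := by
    rw [hf.antisymm u v, hg.antisymm u v]
    ring
  mem u v h := by
    by_contra hu
    have h1 : f u v = 0 := not_not.1 fun h1 => hu (hf.mem u v h1)
    have h2 : g u v = 0 := not_not.1 fun h2 => hu (hg.mem u v h2)
    exact h (by rw [h1, h2]; ring)
  div u := by
    rw [Finset.sum_add_distrib, ← Finset.mul_sum, hf.div, hg.div]
    simp

lemma zero (V : Finset P) : IsFlow V (fun _ _ => 0) 0 where
  antisymm _ _ := by simp
  mem _ _ h := absurd rfl h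
  div _ := by simp

/-- The unit flow along a single edge. -/
lemma edge {a b : P} (ha : a ∈ V) (hb : b ∈ V) :
    IsFlow V (fun u v => Finsupp.single a 1 u * Finsupp.single b 1 v
      - Finsupp.single b 1 u * Finsupp.single a 1 v)
      (Finsupp.single a 1 - Finsupp.single b 1) where
  antisymm u v := by ring
  mem u v h := by
    by_contra hu
    have h1 : a ≠ u := by rintro rfl; exact hu ha
    have h2 : b ≠ u := by rintro rfl; exact hu hb
    exact h (by simp [Finsupp.single_apply, h1, h2])
  div u := by
    rw [Finset.sum_sub_distrib, ← Finset.mul_sum, ← Finset.mul_sum]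
    simp [Finsupp.single_apply, ha, hb]

lemma edge_eq_zero {a b u v : P} (h1 : ¬ (a = u ∧ b = v)) (h2 : ¬ (b = u ∧ a = v)) :
    Finsupp.single a (1 : ℝ) u * Finsupp.single b (1 : ℝ) v
      - Finsupp.single b (1 : ℝ) u * Finsupp.single a (1 : ℝ) v = 0 := by
  simp only [Finsupp.single_apply]
  split_ifs <;> simp_all

/-- The net outflow of a set of vertices is the flow across its boundary. -/
lemma sum_div_eq (hf : IsFlow V f c) (K : Set P) :
    ∑ z ∈ V.filter (· ∈ K), c z
      = ∑ z ∈ V.filter (· ∈ K), ∑ w ∈ V.filter (· ∉ K), f z w := by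
  have h0 : ∑ z ∈ V.filter (· ∈ K), ∑ w ∈ V.filter (· ∈ K), f z w = 0 := by
    have h1 : ∑ z ∈ V.filter (· ∈ K), ∑ w ∈ V.filter (· ∈ K), f z w
        = -∑ z ∈ V.filter (· ∈ K), ∑ w ∈ V.filter (· ∈ K), f z w := by
      conv_lhs => rw [Finset.sum_comm]
      rw [← Finset.sum_neg_distrib]
      refine Finset.sum_congr rfl fun z _ => ?_
      rw [← Finset.sum_neg_distrib]
      exact Finset.sum_congr rfl fun w _ => hf.antisymm w z
    linarith
  have h2 : ∀ z, c z = ∑ w ∈ V.filter (· ∈ K), f z w + ∑ w ∈ V.filter (· ∉ K), f z w := by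
    intro z
    rw [Finset.sum_filter_add_sum_filter_not, hf.div]
  rw [Finset.sum_congr rfl fun z _ => h2 z, Finset.sum_add_distrib, h0, zero_add]

lemma sum_div_eq_zero_of_closed (hf : IsFlow V f c) (K : Set P)
    (hK : ∀ z w, z ∈ K → w ∉ K → f z w = 0) : ∑ z ∈ V.filter (· ∈ K), c z = 0 := by
  rw [hf.sum_div_eq K]
  refine Finset.sum_eq_zero fun z hz => Finset.sum_eq_zero fun w hw => ?_
  exact hK z w (Finset.mem_filter.1 hz).2 (Finset.mem_filter.1 hw).2

/-- Across a bridge, a flow carries exactly the net outflow of the component at its source. -/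
lemma eq_sum_of_isBridge (hf : IsFlow V f c) {H : SimpleGraph P}
    (hH : ∀ z w, f z w ≠ 0 → H.Adj z w) {u v : P} (hb : H.IsBridge s(u, v)) :
    f v u
      = ∑ z ∈ V.filter (· ∈ {z | (H.deleteEdges {s(u, v)}).Reachable v z}), c z := by
  set K : Set P := {z | (H.deleteEdges {s(u, v)}).Reachable v z} with hKdef
  have hvK : v ∈ K := SimpleGraph.Reachable.refl v
  have huK : u ∉ K := fun h => SimpleGraph.isBridge_iff.1 hb (SimpleGraph.Reachable.symm h)
  have hcut : ∀ z w, z ∈ K → w ∉ K → f z w ≠ 0 → z = v ∧ w = u := by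
    intro z w hz hw h
    have hadj := hH z w h
    have hmem : s(z, w) = s(u, v) := by
      by_contra hne
      refine hw (SimpleGraph.Reachable.trans hz (SimpleGraph.Adj.reachable ?_))
      rw [SimpleGraph.deleteEdges_adj]
      exact ⟨hadj, hne⟩
    rcases Sym2.eq_iff.1 hmem with ⟨rfl, rfl⟩ | ⟨rfl, rfl⟩
    · exact absurd hvK hw
    · exact ⟨rfl, rfl⟩
  rw [hf.sum_div_eq K]
  by_cases h0 : f v u = 0
  · rw [h0]
    refine (Finset.sum_eq_zero fun z hz => Finset.sum_eq_zero fun w hw => ?_).symm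
    by_contra h
    obtain ⟨rfl, rfl⟩ :=
      hcut z w (Finset.mem_filter.1 hz).2 (Finset.mem_filter.1 hw).2 h
    exact h h0
  · rw [Finset.sum_eq_single_of_mem v (Finset.mem_filter.2 ⟨hf.mem _ _ h0, hvK⟩),
      Finset.sum_eq_single_of_mem u (Finset.mem_filter.2 ⟨hf.mem_right _ _ h0, huK⟩)]
    · intro w hw hne
      by_contra h
      exact hne (hcut v w hvK (Finset.mem_filter.1 hw).2 h).2
    · intro z hz hne
      refine Finset.sum_eq_zero fun w hw => ?_
      by_contra h
      exact hne (hcut z w (Finset.mem_filter.1 hz).2 (Finset.mem_filter.1 hw).2 h).1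

/-- A unit flow between two vertices that are connected in a graph. -/
lemma exists_of_reachable {H : SimpleGraph P} (hH : ∀ u v, H.Adj u v → u ∈ V) {a b : P}
    (h : H.Reachable a b) :
    ∃ p : P → P → ℝ, IsFlow V p (Finsupp.single a 1 - Finsupp.single b 1) ∧
      ∀ u v, p u v ≠ 0 → H.Adj u v := by
  obtain ⟨w⟩ := h
  induction w with
  | nil =>
    refine ⟨fun _ _ => 0, ?_, fun _ _ h => absurd rfl h⟩
    rw [sub_self]
    exact zero V
  | @cons a b c hab _ ih =>
    obtain ⟨p, hp, hsupp⟩ := ih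
    have hq := hp.add_smul (edge (hH a b hab) (hH b a hab.symm)) 1
    rw [one_smul, add_comm, sub_add_sub_cancel] at hq
    refine ⟨_, hq, fun u v huv => ?_⟩
    by_contra hn
    have h0 : p u v = 0 := not_not.1 fun h0 => hn (hsupp u v h0)
    refine huv ?_
    rw [h0, edge_eq_zero]
    · ring
    · rintro ⟨rfl, rfl⟩
      exact hn hab
    · rintro ⟨rfl, rfl⟩
      exact hn hab.symm

/-- A flow whose graph contains a cycle shares its support with a nonzero circulation. -/
lemma exists_circulation (hf : IsFlow V f c) (hcyc : ¬ (flowGraph f).IsAcyclic) :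
    ∃ q : P → P → ℝ, IsFlow V q 0 ∧ (∀ u v, f u v = 0 → q u v = 0) ∧ ∃ u v, 0 < q u v := by
  rw [SimpleGraph.isAcyclic_iff_forall_adj_isBridge] at hcyc
  push Not at hcyc
  obtain ⟨a, b, hab, hbr⟩ := hcyc
  rw [SimpleGraph.isBridge_iff, not_not] at hbr
  have hV : ∀ u v, (flowGraph f).Adj u v → u ∈ V := fun u v h => hf.mem u v (hf.adj_iff.1 h)
  obtain ⟨p, hp, hsupp⟩ := exists_of_reachable (V := V)
    (fun u v h => hV u v (SimpleGraph.deleteEdges_le _ h)) hbr.symm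
  have hne : a ≠ b := hab.ne
  have hq := hp.add_smul (edge (hV a b hab) (hV b a hab.symm)) 1
  rw [one_smul, sub_add_sub_cancel, sub_self] at hq
  refine ⟨_, hq, fun u v huv => ?_, a, b, ?_⟩
  · have h0 : p u v = 0 := by
      by_contra h0
      exact hf.adj_iff.1 (SimpleGraph.deleteEdges_le _ (hsupp u v h0)) huv
    rw [h0, edge_eq_zero]
    · ring
    · rintro ⟨rfl, rfl⟩
      exact hf.adj_iff.1 hab huv
    · rintro ⟨rfl, rfl⟩
      exact hf.adj_iff.1 hab.symm huv
  · have h0 : p a b = 0 := by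
      by_contra h0
      simpa using hsupp a b h0
    simp [h0, hne, hne.symm]

/-- Moving a flow along a direction supported on it, until some edge is emptied for the first
time. -/
lemma exists_first_zero (hf : IsFlow V f c) {q : P → P → ℝ} (hpos : ∃ u v, 0 < f u v * q u v) :
    ∃ t : ℝ, 0 < t ∧ (∀ u v, 0 ≤ f u v * (f u v + -t * q u v)) ∧
      ∃ u v, f u v ≠ 0 ∧ f u v + -t * q u v = 0 := by
  obtain ⟨a, b, hab⟩ := hpos
  have hfab : f a b ≠ 0 := fun h => by simp [h] at hab
  obtain ⟨e, he, hmin⟩ := Finset.exists_min_image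
    ((V ×ˢ V).filter fun e => 0 < f e.1 e.2 * q e.1 e.2) (fun e => f e.1 e.2 / q e.1 e.2)
    ⟨(a, b), Finset.mem_filter.2 ⟨Finset.mem_product.2 ⟨hf.mem _ _ hfab, hf.mem_right _ _ hfab⟩,
      hab⟩⟩
  have he' := (Finset.mem_filter.1 he).2
  have hfe : f e.1 e.2 ≠ 0 := fun h => by simp [h] at he'
  have hqe : q e.1 e.2 ≠ 0 := fun h => by simp [h] at he'
  have ht : 0 < f e.1 e.2 / q e.1 e.2 := by
    rcases pos_and_pos_or_neg_and_neg_of_mul_pos he' with h | h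
    · exact div_pos h.1 h.2
    · exact div_pos_of_neg_of_neg h.1 h.2
  refine ⟨f e.1 e.2 / q e.1 e.2, ht, fun u v => ?_, e.1, e.2, hfe, by field_simp; ring⟩
  rcases le_or_gt (f u v * q u v) 0 with h | h
  · nlinarith [mul_self_nonneg (f u v)]
  · have hfu : f u v ≠ 0 := fun h' => by simp [h'] at h
    have hqu : q u v ≠ 0 := fun h' => by simp [h'] at h
    have h1 := hmin (u, v) (Finset.mem_filter.2
      ⟨Finset.mem_product.2 ⟨hf.mem _ _ hfu, hf.mem_right _ _ hfu⟩, h⟩)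
    simp only at h1
    have h2 := mul_nonneg h.le (sub_nonneg.2 h1)
    have e1 : f u v * q u v * (f u v / q u v - f e.1 e.2 / q e.1 e.2)
        = f u v * (f u v + -(f e.1 e.2 / q e.1 e.2) * q u v) := by
      have : f u v = f u v / q u v * q u v := by field_simp
      linear_combination (-f u v) * this
    linarith

lemma card_support_lt (hf : IsFlow V f c) (hfg : ∀ u v, f u v = 0 → g u v = 0)
    (hlt : ∃ u v, f u v ≠ 0 ∧ g u v = 0) :
    ((V ×ˢ V).filter fun e => g e.1 e.2 ≠ 0).card
      < ((V ×ˢ V).filter fun e => f e.1 e.2 ≠ 0).card := by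
  obtain ⟨a, b, hab, hg⟩ := hlt
  refine Finset.card_lt_card ⟨fun e he => ?_, fun h => ?_⟩
  · rw [Finset.mem_filter] at he ⊢
    exact ⟨he.1, fun h => he.2 (hfg _ _ h)⟩
  · have := h (show (a, b) ∈ _ from Finset.mem_filter.2
      ⟨Finset.mem_product.2 ⟨hf.mem _ _ hab, hf.mem_right _ _ hab⟩, hab⟩)
    exact (Finset.mem_filter.1 this).2 hg

section Cost

variable [PseudoMetricSpace P] {α : ℝ}

/-- Cancelling a cycle of a flow shrinks its support without increasing the cost. -/
lemma exists_card_support_lt (hα0 : 0 ≤ α) (hα1 : α ≤ 1) (hf : IsFlow V f c)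
    (hcyc : ¬ (flowGraph f).IsAcyclic) :
    ∃ g, IsFlow V g c ∧ flowCost α V g ≤ flowCost α V f ∧
      ((V ×ˢ V).filter fun e => g e.1 e.2 ≠ 0).card
        < ((V ×ˢ V).filter fun e => f e.1 e.2 ≠ 0).card := by
  obtain ⟨q, hq, hsupp, hpos⟩ : ∃ q : P → P → ℝ, IsFlow V q 0 ∧
      (∀ u v, f u v = 0 → q u v = 0) ∧ ∃ u v, 0 < f u v * q u v := by
    obtain ⟨q, hq, hsupp, a, b, hab⟩ := hf.exists_circulation hcyc
    have hfab : f a b ≠ 0 := fun h => hab.ne' (hsupp a b h)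
    rcases lt_or_gt_of_ne hfab with h | h
    · have hq' := (zero V).add_smul hq (-1)
      rw [smul_zero, add_zero] at hq'
      exact ⟨_, hq', fun u v h => by simp [hsupp u v h], a, b, by nlinarith⟩
    · exact ⟨q, hq, hsupp, a, b, mul_pos h hab⟩
  obtain ⟨s, hs, hsign, hzero⟩ := hf.exists_first_zero hpos
  have hfs := hf.add_smul hq (-s)
  rw [smul_zero, add_zero] at hfs
  have hcard := hf.card_support_lt (g := fun u v => f u v + -s * q u v)
    (fun u v h => by simp [h, hsupp u v h]) hzero
  by_cases hneg : ∃ u v, 0 < f u v * -q u v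
  · obtain ⟨t, ht, hsign', hzero'⟩ := hf.exists_first_zero (q := fun u v => -q u v) hneg
    simp only [neg_mul_neg] at hsign' hzero'
    have hft := hf.add_smul hq t
    rw [smul_zero, add_zero] at hft
    have hcard' := hf.card_support_lt (g := fun u v => f u v + t * q u v)
      (fun u v h => by simp [h, hsupp u v h]) hzero'
    have hsum : t * flowCost α V (fun u v => f u v + -s * q u v)
        + s * flowCost α V (fun u v => f u v + t * q u v) ≤ (s + t) * flowCost α V f := by
      simp only [flowCost, Finset.mul_sum]
      rw [← Finset.sum_add_distrib]
      refine Finset.sum_le_sum fun u _ => ?_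
      rw [← Finset.sum_add_distrib]
      refine Finset.sum_le_sum fun v _ => ?_
      have e1 : f u v + -s * q u v = f u v - s * q u v := by ring
      have h1 := hsign u v
      rw [e1] at h1 ⊢
      have := edgeCost_concave_of_same_sign hα0 hα1 hs ht (hsupp u v) h1 (hsign' u v)
      nlinarith [mul_le_mul_of_nonneg_right this (dist_nonneg (x := u) (y := v))]
    by_cases hle : flowCost α V (fun u v => f u v + -s * q u v) ≤ flowCost α V f
    · exact ⟨_, hfs, hle, hcard⟩
    · exact ⟨_, hft, by nlinarith, hcard'⟩
  · push Not at hneg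
    refine ⟨_, hfs, Finset.sum_le_sum fun u _ => Finset.sum_le_sum fun v _ =>
      mul_le_mul_of_nonneg_right (edgeCost_mono_abs hα0 ?_) dist_nonneg, hcard⟩
    have h1 := hsign u v
    have h2 : 0 ≤ f u v * q u v := by linarith [hneg u v]
    rw [← sq_le_sq]
    have h3 : f u v * f u v = 0 ∨ 0 < f u v * f u v :=
      (mul_self_nonneg (f u v)).eq_or_lt.imp_left Eq.symm
    rcases h3 with h3 | h3
    · have h4 := mul_self_eq_zero.1 h3
      simp [h4, hsupp u v h4]
    · have h5 : f u v * f u v * (f u v ^ 2 - (f u v + -s * q u v) ^ 2)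
          = (s * (f u v * q u v)) * (f u v * f u v + f u v * (f u v + -s * q u v)) := by ring
      have h6 : 0 ≤ f u v * f u v * (f u v ^ 2 - (f u v + -s * q u v) ^ 2) := by
        rw [h5]
        positivity
      linarith [nonneg_of_mul_nonneg_right h6 h3]

/-- Every flow can be replaced by one without cycles at no extra cost. -/
lemma exists_isAcyclic (hα0 : 0 ≤ α) (hα1 : α ≤ 1) (hf : IsFlow V f c) :
    ∃ g, IsFlow V g c ∧ (flowGraph g).IsAcyclic ∧ flowCost α V g ≤ flowCost α V f := by
  induction h : ((V ×ˢ V).filter fun e => f e.1 e.2 ≠ 0).card using Nat.strong_induction_on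
    generalizing f with
  | _ N ih =>
    by_cases hcyc : (flowGraph f).IsAcyclic
    · exact ⟨f, hf, hcyc, le_rfl⟩
    · obtain ⟨g, hg, hle, hlt⟩ := hf.exists_card_support_lt hα0 hα1 hcyc
      obtain ⟨g', hg', hac, hle'⟩ := ih _ (h ▸ hlt) hg rfl
      exact ⟨g', hg', hac, hle'.trans hle⟩

/-- The total length of a unit flow is at least the distance of its endpoints. -/
lemma two_mul_dist_le {p : P → P → ℝ} {x y : P} (hx : x ∈ V) (hy : y ∈ V)
    (hp : IsFlow V p (Finsupp.single x 1 - Finsupp.single y 1)) :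
    2 * dist x y ≤ ∑ u ∈ V, ∑ v ∈ V, |p u v| * dist u v := by
  have h1 : ∑ u ∈ V, ∑ v ∈ V, p u v * dist x u = -dist x y := by
    have : ∀ u ∈ V, ∑ v ∈ V, p u v * dist x u
        = Finsupp.single x (1 : ℝ) u * dist x u - Finsupp.single y (1 : ℝ) u * dist x u := by
      intro u _
      rw [← Finset.sum_mul, hp.div, Finsupp.sub_apply, sub_mul]
    rw [Finset.sum_congr rfl this, Finset.sum_sub_distrib]
    simp [Finsupp.single_apply, hx, hy]
  have h2 : ∑ u ∈ V, ∑ v ∈ V, p u v * dist x v = dist x y := by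
    rw [Finset.sum_comm, ← neg_neg (dist x y), ← h1, ← Finset.sum_neg_distrib]
    refine Finset.sum_congr rfl fun u _ => ?_
    rw [← Finset.sum_neg_distrib]
    refine Finset.sum_congr rfl fun v _ => ?_
    rw [hp.antisymm v u]
    ring
  calc 2 * dist x y = ∑ u ∈ V, ∑ v ∈ V, p u v * (dist x v - dist x u) := by
        simp only [mul_sub, Finset.sum_sub_distrib]
        rw [h1, h2]
        ring
    _ ≤ _ := Finset.sum_le_sum fun u _ => Finset.sum_le_sum fun v _ => by
        refine (le_abs_self _).trans ?_
        rw [abs_mul]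
        refine mul_le_mul_of_nonneg_left ?_ (abs_nonneg _)
        rw [abs_le]
        constructor <;> linarith [dist_triangle x u v, dist_triangle x v u, dist_comm u v]

/-- Removing mass `n` at `y` from an acyclic flow issuing from `x` with mass `m` saves at least
`m^α - (m - n)^α` per unit of the distance from `x` to `y`. -/
lemma exists_sub_of_isAcyclic (hα0 : 0 ≤ α) (hα1 : α ≤ 1) {x y : P} {m n : ℝ} {b : P →₀ ℝ}
    (hf : IsFlow V f (Finsupp.single x m - b)) (hac : (flowGraph f).IsAcyclic)
    (hx : x ∈ V) (hy : y ∈ V) (hb : ∀ z, 0 ≤ b z) (hn : 0 < n) (hny : n ≤ b y) :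
    ∃ g, IsFlow V g (Finsupp.single x (m - n) - (b - Finsupp.single y n)) ∧
      flowCost α V g
        ≤ flowCost α V f - 2 * ((edgeCost α m - edgeCost α (m - n)) * dist x y) := by
  have hsingle : ∀ (K : Set P) (a : P) (t : ℝ), a ∈ V →
      ∑ z ∈ V.filter (· ∈ K), Finsupp.single a t z = if a ∈ K then t else 0 := by
    intro K a t ha
    simp [Finsupp.single_apply, ha]
  have hsum : ∀ K : Set P, ∑ z ∈ V.filter (· ∈ K), (Finsupp.single x m - b) z
      = (if x ∈ K then m else 0) - ∑ z ∈ V.filter (· ∈ K), b z := by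
    intro K
    simp only [Finsupp.sub_apply, Finset.sum_sub_distrib]
    rw [hsingle K x m hx]
  have hbn : ∀ T : Finset P, y ∈ T → n ≤ ∑ z ∈ T, b z := fun T hT =>
    hny.trans (Finset.single_le_sum (f := fun z => b z) (fun z _ => hb z) hT)
  have hm : ∑ z ∈ V, b z = m := by
    have h := hf.sum_div_eq_zero_of_closed Set.univ (fun _ w _ hw => absurd (Set.mem_univ w) hw)
    rw [hsum] at h
    simp only [Set.mem_univ, if_true, Finset.filter_true] at h
    linarith
  have hreach : (flowGraph f).Reachable x y := by
    by_contra hxy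
    have h := hf.sum_div_eq_zero_of_closed {z | (flowGraph f).Reachable y z} (by
      intro z w hz hw
      by_contra h
      exact hw (SimpleGraph.Reachable.trans hz (hf.adj_iff.2 h).reachable))
    rw [hsum, if_neg (show x ∉ {z | (flowGraph f).Reachable y z} from
      fun h : (flowGraph f).Reachable y x => hxy h.symm)] at h
    linarith [hbn _ (Finset.mem_filter.2 ⟨hy, show y ∈ {z | (flowGraph f).Reachable y z} from
      SimpleGraph.Reachable.refl y⟩)]
  obtain ⟨p, hp, hpf⟩ := exists_of_reachable (V := V)
    (fun u v h => hf.mem u v (hf.adj_iff.1 h)) hreach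
  have hedge : ∀ u v, p u v = 0 ∨ (p u v = 1 ∧ n ≤ f u v ∧ f u v ≤ m) ∨
      (p u v = -1 ∧ n ≤ -f u v ∧ -f u v ≤ m) := by
    intro u v
    by_cases h0 : p u v = 0
    · exact Or.inl h0
    have hbr := SimpleGraph.isAcyclic_iff_forall_adj_isBridge.1 hac (hpf u v h0)
    obtain ⟨K, h1, h2⟩ : ∃ K : Set P,
        f v u = ∑ z ∈ V.filter (· ∈ K), (Finsupp.single x m - b) z ∧
        p v u = ∑ z ∈ V.filter (· ∈ K), (Finsupp.single x 1 - Finsupp.single y 1 : P →₀ ℝ) z :=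
      ⟨_, hf.eq_sum_of_isBridge (fun z w h => hf.adj_iff.2 h) hbr,
        hp.eq_sum_of_isBridge hpf hbr⟩
    rw [hsum] at h1
    simp only [Finsupp.sub_apply, Finset.sum_sub_distrib] at h2
    rw [hsingle K x 1 hx, hsingle K y 1 hy] at h2
    have hle : ∑ z ∈ V.filter (· ∈ K), b z ≤ m := by
      rw [← hm]
      exact Finset.sum_le_sum_of_subset_of_nonneg (Finset.filter_subset _ _) fun z _ _ => hb z
    have hge : 0 ≤ ∑ z ∈ V.filter (· ∈ K), b z := Finset.sum_nonneg fun z _ => hb z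
    have hsplit : ∑ z ∈ V.filter (· ∈ K), b z + ∑ z ∈ V.filter (· ∉ K), b z = m := by
      rw [← hm]
      exact Finset.sum_filter_add_sum_filter_not V (· ∈ K) _
    rw [hf.antisymm v u] at h1
    rw [hp.antisymm v u] at h2
    by_cases hxK : x ∈ K <;> by_cases hyK : y ∈ K <;>
      simp only [hxK, hyK, if_true, if_false] at h1 h2
    · exact Or.inl (by linarith)
    · have := hbn (V.filter (· ∉ K)) (Finset.mem_filter.2 ⟨hy, hyK⟩)
      exact Or.inr (Or.inr ⟨by linarith, by linarith, by linarith⟩)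
    · have := hbn (V.filter (· ∈ K)) (Finset.mem_filter.2 ⟨hy, hyK⟩)
      exact Or.inr (Or.inl ⟨by linarith, by linarith, by linarith⟩)
    · exact Or.inl (by linarith)
  have hnm : n ≤ m := by
    rw [← hm]
    exact hbn V hy
  have hκ : 0 ≤ edgeCost α m - edgeCost α (m - n) := by
    refine sub_nonneg.2 (edgeCost_mono_abs hα0 ?_)
    rw [abs_of_nonneg (by linarith), abs_of_nonneg (by linarith)]
    linarith
  have hsave : ∀ t, n ≤ t → t ≤ m →
      edgeCost α m - edgeCost α (m - n) ≤ edgeCost α t - edgeCost α (t - n) := by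
    intro t h1 h2
    have := edgeCost_increment hα0 hα1 (a := t - n) (b := m - n) (t := n) (by linarith)
      (by linarith) hn.le
    simpa using this
  have hg := hf.add_smul hp (-n)
  have hdiv : Finsupp.single x m - b + -n • (Finsupp.single x (1 : ℝ) - Finsupp.single y 1)
      = Finsupp.single x (m - n) - (b - Finsupp.single y n) := by
    ext z
    simp only [Finsupp.add_apply, Finsupp.sub_apply, Finsupp.smul_apply, Finsupp.single_apply,
      smul_eq_mul]
    split_ifs <;> ring
  rw [hdiv] at hg
  refine ⟨_, hg, ?_⟩
  have hlen := mul_le_mul_of_nonneg_left (hp.two_mul_dist_le hx hy) hκ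
  have hcost : flowCost α V (fun u v => f u v + -n * p u v)
      + (edgeCost α m - edgeCost α (m - n)) * ∑ u ∈ V, ∑ v ∈ V, |p u v| * dist u v
      ≤ flowCost α V f := by
    simp only [flowCost, Finset.mul_sum]
    rw [← Finset.sum_add_distrib]
    refine Finset.sum_le_sum fun u _ => ?_
    rw [← Finset.sum_add_distrib]
    refine Finset.sum_le_sum fun v _ => ?_
    rw [← mul_assoc, ← add_mul]
    refine mul_le_mul_of_nonneg_right ?_ dist_nonneg
    rcases hedge u v with h | ⟨h, h1, h2⟩ | ⟨h, h1, h2⟩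
    · simp [h]
    · have := hsave _ h1 h2
      have e : f u v + -n * 1 = f u v - n := by ring
      rw [h, e, abs_one]
      linarith
    · have := hsave _ h1 h2
      have e : f u v + -n * -1 = -(-f u v - n) := by ring
      rw [edgeCost_neg] at this
      rw [h, e, edgeCost_neg, abs_neg, abs_one]
      linarith
  linarith

lemma flowCost_edge_le {x y : P} {n : ℝ} (hα0 : 0 ≤ α) (hα1 : α ≤ 1) (hx : x ∈ V) (hy : y ∈ V)
    (f : P → P → ℝ) :
    flowCost α V (fun u v => f u v + n * (Finsupp.single x 1 u * Finsupp.single y 1 v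
      - Finsupp.single y 1 u * Finsupp.single x 1 v))
      ≤ flowCost α V f + 2 * (edgeCost α n * dist x y) := by
  have hsum : ∀ a ∈ V, ∀ b ∈ V, ∑ u ∈ V, ∑ v ∈ V,
      edgeCost α n * (Finsupp.single a (1 : ℝ) u * Finsupp.single b (1 : ℝ) v) * dist u v
        = edgeCost α n * dist a b := by
    intro a ha b hb
    rw [Finset.sum_eq_single_of_mem a ha, Finset.sum_eq_single_of_mem b hb]
    · simp
    · intro v _ hv
      simp [hv.symm]
    · intro u _ hu
      exact Finset.sum_eq_zero fun v _ => by simp [Finsupp.single_apply, hu.symm]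
  have h : flowCost α V f + 2 * (edgeCost α n * dist x y)
      = ∑ u ∈ V, ∑ v ∈ V, (edgeCost α (f u v) * dist u v
        + edgeCost α n * (Finsupp.single x (1 : ℝ) u * Finsupp.single y (1 : ℝ) v) * dist u v
        + edgeCost α n * (Finsupp.single y (1 : ℝ) u * Finsupp.single x (1 : ℝ) v) * dist u v) := by
    simp only [Finset.sum_add_distrib]
    rw [hsum x hx y hy, hsum y hy x hx, dist_comm y x, flowCost]
    ring
  rw [h, flowCost]
  refine Finset.sum_le_sum fun u _ => Finset.sum_le_sum fun v _ => ?_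
  rw [← add_mul, ← add_mul]
  refine mul_le_mul_of_nonneg_right ?_ dist_nonneg
  refine (edgeCost_add_le hα0 hα1 _ _).trans ?_
  rw [add_assoc]
  have hC := edgeCost_nonneg (α := α) n
  have hneg := edgeCost_neg (α := α) n
  have h0 := edgeCost_zero (α := α)
  refine add_le_add_right ?_ _
  simp only [Finsupp.single_apply]
  split_ifs <;> simp [h0, hneg, hC]

end Cost

end IsFlow

/-! ### Transport paths as signed flows -/

namespace WDG

variable {m : ℕ} {G : WDG m} {V : Finset (Pt m)} {α : ℝ}

/-- The weight of an edge, extended by zero to all pairs of points. -/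
def weight (G : WDG m) (u v : Pt m) : ℝ := if (u, v) ∈ G.E then G.w (u, v) else 0

lemma sum_edges_eq (hG : G.edgesOK) (hV : G.V ⊆ V) (h : Pt m × Pt m → ℝ) :
    ∑ e ∈ G.E, h e = ∑ u ∈ V, ∑ v ∈ V, if (u, v) ∈ G.E then h (u, v) else 0 := by
  rw [← Finset.sum_product' V V fun u v => if (u, v) ∈ G.E then h (u, v) else 0,
    ← Finset.sum_filter]
  refine Finset.sum_congr ?_ fun _ _ => rfl
  ext e
  rw [Finset.mem_filter, Finset.mem_product]
  exact ⟨fun he => ⟨⟨hV (hG e he).1, hV (hG e he).2.1⟩, he⟩, fun he => he.2⟩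

lemma outflow_eq (hG : G.edgesOK) (hV : G.V ⊆ V) (u : Pt m) :
    G.outflow u = ∑ v ∈ V, G.weight u v := by
  rw [outflow, Finset.sum_filter, sum_edges_eq hG hV]
  by_cases hu : u ∈ V
  · rw [Finset.sum_eq_single_of_mem u hu]
    · simp [weight]
    · intro z _ hz
      simp [hz]
  · have hu' : ∀ v, (u, v) ∉ G.E := fun v h => hu (hV (hG _ h).1)
    rw [Finset.sum_eq_zero, Finset.sum_eq_zero]
    · intro v _
      simp [weight, hu']
    · intro z hz
      have : z ≠ u := by rintro rfl; exact hu hz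
      simp [this]

lemma inflow_eq (hG : G.edgesOK) (hV : G.V ⊆ V) (u : Pt m) :
    G.inflow u = ∑ v ∈ V, G.weight v u := by
  rw [inflow, Finset.sum_filter, sum_edges_eq hG hV, Finset.sum_comm]
  by_cases hu : u ∈ V
  · rw [Finset.sum_eq_single_of_mem u hu]
    · simp [weight]
    · intro z _ hz
      simp [hz]
  · have hu' : ∀ v, (v, u) ∉ G.E := fun v h => hu (hV (hG _ h).2.1)
    rw [Finset.sum_eq_zero, Finset.sum_eq_zero]
    · intro v _
      simp [weight, hu']
    · intro z hz
      have : z ≠ u := by rintro rfl; exact hu hz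
      simp [this]

lemma cost_eq (hG : G.edgesOK) (hV : G.V ⊆ V) :
    G.cost α = ∑ u ∈ V, ∑ v ∈ V, edgeCost α (G.weight u v) * dist u v := by
  rw [cost, sum_edges_eq hG hV]
  refine Finset.sum_congr rfl fun u _ => Finset.sum_congr rfl fun v _ => ?_
  by_cases h : (u, v) ∈ G.E
  · simp [weight, h, edgeCost_of_pos (hG _ h).2.2.2]
  · simp [weight, h, edgeCost_zero]

lemma cost_nonneg_s19 (hG : G.edgesOK) : 0 ≤ G.cost α :=
  Finset.sum_nonneg fun e he => mul_nonneg (Real.rpow_nonneg (hG e he).2.2.2.le _) dist_nonneg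

end WDG

variable {m : ℕ} {X : Set (Pt m)} {V : Finset (Pt m)} {α : ℝ} {a b : Pt m →₀ ℝ}

lemma IsTransportPath.exists_isFlow {G : WDG m} (hα0 : 0 ≤ α) (hα1 : α ≤ 1)
    (hG : IsTransportPath X G a b) (hV : G.V ⊆ V) :
    ∃ f, IsFlow V f (a - b) ∧ flowCost α V f ≤ 2 * G.cost α := by
  obtain ⟨hOK, -, -, -, -, hbal⟩ := hG
  refine ⟨fun u v => G.weight u v - G.weight v u, ⟨fun u v => by ring, fun u v h => ?_,
    fun u => ?_⟩, ?_⟩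
  · by_contra hu
    have h1 : (u, v) ∉ G.E := fun h1 => hu (hV (hOK _ h1).1)
    have h2 : (v, u) ∉ G.E := fun h2 => hu (hV (hOK _ h2).2.1)
    exact h (by simp [WDG.weight, h1, h2])
  · rw [Finset.sum_sub_distrib, ← WDG.outflow_eq hOK hV, ← WDG.inflow_eq hOK hV, hbal,
      Finsupp.sub_apply]
  · have h : 2 * G.cost α = ∑ u ∈ V, ∑ v ∈ V,
        (edgeCost α (G.weight u v) * dist u v + edgeCost α (G.weight v u) * dist u v) := by
      simp only [Finset.sum_add_distrib]
      have : ∑ u ∈ V, ∑ v ∈ V, edgeCost α (G.weight v u) * dist u v = G.cost α := by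
        rw [WDG.cost_eq hOK hV, Finset.sum_comm]
        simp only [dist_comm]
      rw [this, ← WDG.cost_eq hOK hV]
      ring
    rw [h]
    refine Finset.sum_le_sum fun u _ => Finset.sum_le_sum fun v _ => ?_
    rw [← add_mul]
    refine mul_le_mul_of_nonneg_right ?_ dist_nonneg
    have := edgeCost_add_le hα0 hα1 (G.weight u v) (-G.weight v u)
    rwa [edgeCost_neg, ← sub_eq_add_neg] at this

lemma IsFlow.exists_isTransportPath {f : Pt m → Pt m → ℝ} (hα0 : 0 ≤ α) (hα1 : α ≤ 1)
    (hf : IsFlow V f (a - b)) (hVX : ↑V ⊆ X) (ha : a.support ⊆ V) (hb : b.support ⊆ V) :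
    ∃ G, IsTransportPath X G a b ∧ 2 * G.cost α ≤ flowCost α V f := by
  obtain ⟨g, hg, hac, hle⟩ := hf.exists_isAcyclic hα0 hα1
  let G : WDG m := ⟨V, (V ×ˢ V).filter fun e => 0 < g e.1 e.2, fun e => g e.1 e.2⟩
  have hmemE : ∀ u v, (u, v) ∈ G.E ↔ 0 < g u v := by
    intro u v
    simp only [G, Finset.mem_filter, Finset.mem_product, and_iff_right_iff_imp]
    exact fun h => ⟨hg.mem _ _ h.ne', hg.mem_right _ _ h.ne'⟩
  have hOK : G.edgesOK := by
    rintro ⟨u, v⟩ he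
    have h := (hmemE u v).1 he
    refine ⟨hg.mem _ _ h.ne', hg.mem_right _ _ h.ne', ?_, h⟩
    rintro (rfl : u = v)
    exact h.ne' (hg.self_eq_zero u)
  have hweight : ∀ u v, G.weight u v = max (g u v) 0 := by
    intro u v
    rw [WDG.weight]
    split_ifs with h
    · exact (max_eq_left ((hmemE u v).1 h).le).symm
    · exact (max_eq_right (not_lt.1 fun h' => h ((hmemE u v).2 h'))).symm
  have hgraph : G.undirected = flowGraph g := by
    ext u v
    rw [hg.adj_iff, WDG.undirected, SimpleGraph.fromRel_adj, hmemE, hmemE, hg.antisymm v u]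
    constructor
    · rintro ⟨-, h | h⟩ h0 <;> linarith
    · intro h
      refine ⟨?_, ?_⟩
      · rintro rfl
        exact h (hg.self_eq_zero u)
      · rcases lt_or_gt_of_ne h with h | h
        · exact Or.inr (by linarith)
        · exact Or.inl h
  have hVG : G.V ⊆ V := Finset.Subset.refl V
  refine ⟨G, ⟨hOK, hVX, ha, hb, hgraph ▸ hac, fun v => ?_⟩, le_trans ?_ hle⟩
  · rw [WDG.outflow_eq hOK hVG, WDG.inflow_eq hOK hVG, ← Finset.sum_sub_distrib,
      ← Finsupp.sub_apply, ← hg.div]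
    refine Finset.sum_congr rfl fun u _ => ?_
    rw [hweight, hweight, hg.antisymm u v, max_comm, max_comm (-g v u) 0]
    rcases le_total (g v u) 0 with h | h
    · rw [max_eq_left h, max_eq_right (by linarith)]
      ring
    · rw [max_eq_right h, max_eq_left (by linarith)]
      ring
  · have hswap : G.cost α = ∑ u ∈ V, ∑ v ∈ V, edgeCost α (G.weight v u) * dist u v := by
      rw [WDG.cost_eq hOK hVG, Finset.sum_comm]
      simp only [dist_comm]
    rw [two_mul]
    nth_rewrite 1 [hswap]
    rw [WDG.cost_eq hOK hVG, ← Finset.sum_add_distrib]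
    refine Finset.sum_le_sum fun u _ => ?_
    rw [← Finset.sum_add_distrib]
    refine Finset.sum_le_sum fun v _ => ?_
    rw [← add_mul]
    refine mul_le_mul_of_nonneg_right (le_of_eq ?_) dist_nonneg
    rw [hweight, hweight, hg.antisymm v u]
    rcases le_total (g u v) 0 with h | h
    · rw [max_eq_left (by linarith), max_eq_right h, edgeCost_zero, edgeCost_neg, add_zero]
    · rw [max_eq_right (by linarith), max_eq_left h, edgeCost_zero, zero_add]

/-! ### Changing the demand at one household -/

lemma dCost_le {G : WDG m} (hG : IsTransportPath X G a b) : dCost X α a b ≤ G.cost α := by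
  refine csInf_le ⟨0, ?_⟩ ⟨G, hG, rfl⟩
  rintro _ ⟨G', hG', rfl⟩
  exact WDG.cost_nonneg_s19 hG'.1

lemma le_dCost {r : ℝ} (hne : ∃ G, IsTransportPath X G a b)
    (h : ∀ G, IsTransportPath X G a b → r ≤ G.cost α) : r ≤ dCost X α a b := by
  obtain ⟨G, hG⟩ := hne
  refine le_csInf ⟨_, G, hG, rfl⟩ ?_
  rintro _ ⟨G', hG', rfl⟩
  exact h G' hG'

/-- Adding mass `n` at `y` costs at most `n^α` per unit of the distance from `x` to `y`. -/
lemma dCost_add_le {x y : Pt m} {M n : ℝ} (hα0 : 0 ≤ α) (hα1 : α ≤ 1) (hx : x ∈ X) (hy : y ∈ X)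
    (hne : ∃ G, IsTransportPath X G (Finsupp.single x M) b) :
    dCost X α (Finsupp.single x (M + n)) (b + Finsupp.single y n)
      ≤ dCost X α (Finsupp.single x M) b + edgeCost α n * dist x y := by
  rw [← sub_le_iff_le_add]
  refine le_dCost hne fun G hG => ?_
  set V := insert x (insert y G.V) with hVdef
  have hxV : x ∈ V := Finset.mem_insert_self _ _
  have hyV : y ∈ V := Finset.mem_insert_of_mem (Finset.mem_insert_self _ _)
  have hGV : G.V ⊆ V := fun z hz => Finset.mem_insert_of_mem (Finset.mem_insert_of_mem hz)
  have hVX : ↑V ⊆ X := by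
    rw [hVdef, Finset.coe_insert, Finset.coe_insert]
    exact Set.insert_subset hx (Set.insert_subset hy hG.2.1)
  obtain ⟨f, hf, hcost⟩ := hG.exists_isFlow hα0 hα1 hGV
  have hg := hf.add_smul (IsFlow.edge hxV hyV) n
  have hdiv : Finsupp.single x M - b + n • (Finsupp.single x (1 : ℝ) - Finsupp.single y 1)
      = Finsupp.single x (M + n) - (b + Finsupp.single y n) := by
    ext z
    simp only [Finsupp.add_apply, Finsupp.sub_apply, Finsupp.smul_apply, Finsupp.single_apply,
      smul_eq_mul]
    split_ifs <;> ring
  rw [hdiv] at hg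
  obtain ⟨G', hG', hcost'⟩ := hg.exists_isTransportPath hα0 hα1 hVX
    (Finsupp.support_single_subset.trans (Finset.singleton_subset_iff.2 hxV))
    (Finsupp.support_add.trans (Finset.union_subset (fun z hz => hGV (hG.2.2.2.1 z hz))
      (Finsupp.support_single_subset.trans (Finset.singleton_subset_iff.2 hyV))))
  have h1 := IsFlow.flowCost_edge_le (n := n) hα0 hα1 hxV hyV f
  have h2 := dCost_le (α := α) hG'
  linarith

/-- Removing mass `n` at `y` from the demand served by `x` with total mass `M` saves at least
`M^α - (M - n)^α` per unit of the distance from `x` to `y`. -/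
lemma dCost_sub_le {x y : Pt m} {M n : ℝ} (hα0 : 0 ≤ α) (hα1 : α ≤ 1) (hx : x ∈ X) (hy : y ∈ X)
    (hb : ∀ z, 0 ≤ b z) (hn : 0 < n) (hny : n ≤ b y)
    (hne : ∃ G, IsTransportPath X G (Finsupp.single x M) b) :
    dCost X α (Finsupp.single x (M - n)) (b - Finsupp.single y n)
        + (edgeCost α M - edgeCost α (M - n)) * dist x y
      ≤ dCost X α (Finsupp.single x M) b := by
  refine le_dCost hne fun G hG => ?_
  set V := insert x (insert y G.V) with hVdef
  have hxV : x ∈ V := Finset.mem_insert_self _ _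
  have hyV : y ∈ V := Finset.mem_insert_of_mem (Finset.mem_insert_self _ _)
  have hGV : G.V ⊆ V := fun z hz => Finset.mem_insert_of_mem (Finset.mem_insert_of_mem hz)
  have hVX : ↑V ⊆ X := by
    rw [hVdef, Finset.coe_insert, Finset.coe_insert]
    exact Set.insert_subset hx (Set.insert_subset hy hG.2.1)
  obtain ⟨f, hf, hcost⟩ := hG.exists_isFlow hα0 hα1 hGV
  obtain ⟨f', hf', hac, hcost'⟩ := hf.exists_isAcyclic hα0 hα1
  obtain ⟨g, hg, hsave⟩ := hf'.exists_sub_of_isAcyclic hα0 hα1 hac hxV hyV hb hn hny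
  obtain ⟨G', hG', hcost''⟩ := hg.exists_isTransportPath hα0 hα1 hVX
    (Finsupp.support_single_subset.trans (Finset.singleton_subset_iff.2 hxV))
    (Finsupp.support_sub.trans (Finset.union_subset (fun z hz => hGV (hG.2.2.2.1 z hz))
      (Finsupp.support_single_subset.trans (Finset.singleton_subset_iff.2 hyV))))
  have h2 := dCost_le (α := α) hG'
  linarith

/-- A single source can be joined to finitely many households by a transport path. -/
lemma exists_isTransportPath_single {ι : Type*} {x : Pt m} (hx : x ∈ X) (T : Finset ι)
    (y : ι → Pt m) (hy : ∀ h ∈ T, y h ∈ X) (n : ι → ℝ) :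
    ∃ G, IsTransportPath X G (Finsupp.single x (∑ h ∈ T, n h))
      (∑ h ∈ T, Finsupp.single (y h) (n h)) := by
  set V := insert x (T.image y) with hVdef
  have hxV : x ∈ V := Finset.mem_insert_self _ _
  have hyV : ∀ h ∈ T, y h ∈ V := fun h hh =>
    Finset.mem_insert_of_mem (Finset.mem_image_of_mem y hh)
  have hVX : ↑V ⊆ X := by
    intro z hz
    rcases Finset.mem_insert.1 hz with rfl | hz
    · exact hx
    · obtain ⟨h, hh, rfl⟩ := Finset.mem_image.1 hz
      exact hy h hh
  have hflow : ∀ T' ⊆ T, ∃ f, IsFlow V f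
      (Finsupp.single x (∑ h ∈ T', n h) - ∑ h ∈ T', Finsupp.single (y h) (n h)) := by
    intro T'
    induction T' using Finset.induction_on with
    | empty =>
      intro _
      refine ⟨fun _ _ => 0, ?_⟩
      rw [Finset.sum_empty, Finset.sum_empty, Finsupp.single_zero, sub_self]
      exact IsFlow.zero V
    | insert h T' hh ih =>
      intro hT
      obtain ⟨f, hf⟩ := ih ((Finset.subset_insert _ _).trans hT)
      have hg := hf.add_smul (IsFlow.edge hxV (hyV h (hT (Finset.mem_insert_self _ _)))) (n h)
      rw [smul_sub, Finsupp.smul_single, Finsupp.smul_single, smul_eq_mul, mul_one,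
        sub_add_sub_comm, ← Finsupp.single_add, add_comm, add_comm (∑ h ∈ T', _),
        ← Finset.sum_insert hh, ← Finset.sum_insert (f := fun h => Finsupp.single (y h) (n h)) hh]
        at hg
      exact ⟨_, hg⟩
  obtain ⟨f, hf⟩ := hflow T (Finset.Subset.refl T)
  obtain ⟨G, hG, -⟩ := hf.exists_isTransportPath zero_le_one le_rfl hVX
    (Finsupp.support_single_subset.trans (Finset.singleton_subset_iff.2 hxV)) (by
      refine Finsupp.support_finsetSum.trans (Finset.biUnion_subset.2 fun h hh => ?_)
      exact Finsupp.support_single_subset.trans (Finset.singleton_subset_iff.2 (hyV h hh)))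
  exact ⟨G, hG⟩

lemma rho_mul_le {α : ℝ} (hα0 : 0 ≤ α) (hα1 : α ≤ 1) {σ ε M : ℝ} (hε : 0 < ε) (hεM : ε ≤ M)
    (hMσ : M ≤ σ) : rho α σ ε * ε ^ α ≤ edgeCost α M - edgeCost α (M - ε) := by
  have hmono := edgeCost_increment hα0 hα1 (a := M - ε) (b := σ - ε) (t := ε) (by linarith)
    (by linarith) hε.le
  rw [sub_add_cancel, sub_add_cancel] at hmono
  refine le_trans (le_of_eq ?_) hmono
  rcases (hεM.trans hMσ).eq_or_lt with rfl | h
  · simp [rho, edgeCost_zero, edgeCost_of_pos hε]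
  · have h1 : 0 < σ - ε := by linarith
    have e : σ / ε - 1 = (σ - ε) / ε := by field_simp
    have hne : ε ^ α ≠ 0 := (Real.rpow_pos_of_pos hε α).ne'
    rw [rho, if_neg h.ne', e, Real.div_rpow (by linarith) hε.le, Real.div_rpow h1.le hε.le,
      edgeCost_of_pos (by linarith), edgeCost_of_pos h1]
    field_simp

/-! ### Reassigning one household -/

section Reassign

variable {m k ℓ : ℕ} (y : Fin ℓ → Pt m) (n : Fin ℓ → ℝ) (S : Fin ℓ → Fin k) (j : Fin ℓ)
  {i : Fin k}

/-- Sums over the households of a factory after the household `j` is moved to the factory `i`. -/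
lemma sum_filter_update {M : Type*} [AddCommGroup M] (F : Fin ℓ → M) (r : Fin k) :
    ∑ h ∈ Finset.univ.filter (fun h => Function.update S j i h = r), F h
      = ∑ h ∈ Finset.univ.filter (fun h => S h = r), F h
        + (if r = i then F j else 0) - (if r = S j then F j else 0) := by
  simp only [Finset.sum_filter]
  rw [← Finset.add_sum_erase _ _ (Finset.mem_univ j),
    ← Finset.add_sum_erase Finset.univ (fun h => if S h = r then F h else 0) (Finset.mem_univ j)]
  have h : ∑ h ∈ Finset.univ.erase j, (if Function.update S j i h = r then F h else 0)
      = ∑ h ∈ Finset.univ.erase j, (if S h = r then F h else 0) := by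
    refine Finset.sum_congr rfl fun h hh => ?_
    rw [Function.update_of_ne (Finset.ne_of_mem_erase hh)]
  rw [h, Function.update_self]
  simp only [eq_comm (a := r)]
  abel

lemma bPart_nonneg (hn : ∀ h, 0 ≤ n h) (r : Fin k) (z : Pt m) : 0 ≤ bPart y n S r z := by
  rw [bPart, Finsupp.finsetSum_apply]
  refine Finset.sum_nonneg fun h _ => ?_
  rw [Finsupp.single_apply]
  split_ifs
  exacts [hn h, le_rfl]

lemma le_bPart (hn : ∀ h, 0 ≤ n h) : n j ≤ bPart y n S (S j) (y j) := by
  rw [bPart, Finsupp.finsetSum_apply]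
  refine le_trans (by simp) (Finset.single_le_sum
    (f := fun h => Finsupp.single (y h) (n h) (y j)) (fun h _ => ?_)
    (Finset.mem_filter.2 ⟨Finset.mem_univ j, rfl⟩))
  rw [Finsupp.single_apply]
  split_ifs
  exacts [hn h, le_rfl]

/-- The change of the total cost when the household `j` is moved to another factory. -/
lemma Ealpha_update_le {X : Set (Pt m)} {α : ℝ} (hα0 : 0 ≤ α) (hα1 : α ≤ 1) {x : Fin k → Pt m}
    (hxX : ∀ r, x r ∈ X) (hyX : ∀ h, y h ∈ X) (hn : ∀ h, 0 < n h) (hi : i ≠ S j) :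
    Ealpha X α x y n (Function.update S j i)
        + (edgeCost α (mB n S (S j)) - edgeCost α (mB n S (S j) - n j)) * dist (x (S j)) (y j)
      ≤ Ealpha X α x y n S + edgeCost α (n j) * dist (x i) (y j) := by
  have hne : ∀ r, ∃ G, IsTransportPath X G (Finsupp.single (x r) (mB n S r)) (bPart y n S r) :=
    fun r => exists_isTransportPath_single (hxX r) _ y (fun h _ => hyX h) n
  have hm : ∀ r, mB n (Function.update S j i) r
      = mB n S r + (if r = i then n j else 0) - (if r = S j then n j else 0) :=
    sum_filter_update S j n
  have hb : ∀ r, bPart y n (Function.update S j i) r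
      = bPart y n S r + (if r = i then Finsupp.single (y j) (n j) else 0)
        - (if r = S j then Finsupp.single (y j) (n j) else 0) :=
    sum_filter_update S j fun h => Finsupp.single (y h) (n h)
  have hadd := dCost_add_le (n := n j) hα0 hα1 (hxX i) (hyX j) (hne i)
  have hsub := dCost_sub_le hα0 hα1 (hxX (S j)) (hyX j)
    (bPart_nonneg y n S (fun h => (hn h).le) (S j)) (hn j)
    (le_bPart y n S j fun h => (hn h).le) (hne (S j))
  have hiS : i ∈ Finset.univ.erase (S j) := Finset.mem_erase.2 ⟨hi, Finset.mem_univ i⟩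
  rw [Ealpha, Ealpha, ← Finset.add_sum_erase _ _ (Finset.mem_univ (S j)),
    ← Finset.add_sum_erase _ _ hiS,
    ← Finset.add_sum_erase Finset.univ
      (fun r => dCost X α (Finsupp.single (x r) (mB n S r)) (bPart y n S r))
      (Finset.mem_univ (S j)),
    ← Finset.add_sum_erase (Finset.univ.erase (S j))
      (fun r => dCost X α (Finsupp.single (x r) (mB n S r)) (bPart y n S r)) hiS]
  have hrest : ∑ r ∈ (Finset.univ.erase (S j)).erase i,
        dCost X α (Finsupp.single (x r) (mB n (Function.update S j i) r))
          (bPart y n (Function.update S j i) r)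
      = ∑ r ∈ (Finset.univ.erase (S j)).erase i,
        dCost X α (Finsupp.single (x r) (mB n S r)) (bPart y n S r) := by
    refine Finset.sum_congr rfl fun r hr => ?_
    have h1 := Finset.ne_of_mem_erase hr
    have h2 := Finset.ne_of_mem_erase (Finset.mem_of_mem_erase hr)
    simp [hm, hb, h1, h2]
  rw [hrest]
  simp only [hm, hb, hi, hi.symm, if_true, if_false, add_zero, sub_zero]
  linarith

/-- A household is not assigned to `s` if serving it separately from another factory costs
less than the least saving obtained by dropping it from `s`. -/
lemma IsOptimalAssign.ne_of_lt {X : Set (Pt m)} {α : ℝ} (hα0 : 0 ≤ α) (hα1 : α ≤ 1)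
    {x : Fin k → Pt m} (hS : IsOptimalAssign X α x y n S) (hxX : ∀ r, x r ∈ X)
    (hyX : ∀ h, y h ∈ X) (hn : ∀ h, 0 < n h) {s : Fin k} {σ : ℝ} (hσ : mB n S s ≤ σ)
    (hi : i ≠ s) (hlt : ‖y j - x i‖ < rho α σ (n j) * ‖y j - x s‖) : S j ≠ s := by
  rintro rfl
  have h1 := Ealpha_update_le y n S j hα0 hα1 hxX hyX hn hi
  have h2 := hS (Function.update S j i)
  have hM : n j ≤ mB n S (S j) :=
    Finset.single_le_sum (f := n) (fun h _ => (hn h).le)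
      (Finset.mem_filter.2 ⟨Finset.mem_univ j, rfl⟩)
  have h3 := mul_le_mul_of_nonneg_right (rho_mul_le hα0 hα1 (hn j) hM hσ)
    (norm_nonneg (y j - x (S j)))
  have h4 := mul_lt_mul_of_pos_left hlt (Real.rpow_pos_of_pos (hn j) α)
  rw [edgeCost_of_pos (hn j), dist_comm, dist_comm (x i), dist_eq_norm, dist_eq_norm] at h1
  nlinarith

end Reassign

/-- Let `U` be a state matrix for an optimal assignment map `S`
and `w_i(U) = Σ_h u_(ih) n_h`. (i) If `w_s(U) ≥ n_j` and
`min_(i≠s) ‖y_j − x_i‖ < ρ_α(w_s(U), n_j) ‖y_j − x_s‖` then `S(j) ≠ s`;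
(ii) if `‖y_j − x_s‖ < ρ_α(w_i(U), n_j) ‖y_j − x_i‖` for every `i ≠ s` with
`w_i(U) ≥ n_j`, then `S(j) = s`. -/
theorem stmt_19 {m k ℓ : ℕ} (X : Set (Pt m)) (hXc : IsCompact X) (hXconv : Convex ℝ X)
    (α : ℝ) (hα0 : 0 ≤ α) (hα1 : α < 1)
    (x : Fin k → Pt m) (hxinj : Function.Injective x) (hxX : ∀ i, x i ∈ X)
    (y : Fin ℓ → Pt m) (hyinj : Function.Injective y) (hyX : ∀ j, y j ∈ X)
    (n : Fin ℓ → ℝ) (hn : ∀ j, 0 < n j) (hnsum : ∑ j, n j = 1)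
    (hk : 2 ≤ k) (S : Fin ℓ → Fin k) (hS : IsOptimalAssign X α x y n S)
    (U : Fin k → Fin ℓ → ℝ)
    (hU01 : ∀ (s : Fin k) (h : Fin ℓ), U s h = 0 ∨ U s h = 1)
    (hUst : ∀ (s : Fin k) (h : Fin ℓ), U s h = 0 → S h ≠ s)
    (wU : Fin k → ℝ) (hwU : ∀ i : Fin k, wU i = ∑ h, U i h * n h)
    (j : Fin ℓ) (s : Fin k) :
    ((n j ≤ wU s ∧
        ∃ i : Fin k, i ≠ s ∧ ‖y j - x i‖ < rho α (wU s) (n j) * ‖y j - x s‖) →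
      S j ≠ s) ∧
    ((∀ i : Fin k, i ≠ s → n j ≤ wU i →
        ‖y j - x s‖ < rho α (wU i) (n j) * ‖y j - x i‖) → S j = s) := by
  have hw : ∀ i, mB n S i ≤ wU i := by
    intro i
    rw [hwU, mB, Finset.sum_filter]
    refine Finset.sum_le_sum fun h _ => ?_
    rcases hU01 i h with h0 | h0
    · rw [if_neg (hUst i h h0), h0, zero_mul]
    · rw [h0, one_mul]
      split_ifs
      exacts [le_rfl, (hn h).le]
  refine ⟨?_, fun hlt => ?_⟩
  · rintro ⟨-, i, hi, hlt⟩
    exact hS.ne_of_lt y n S j hα0 hα1.le hxX hyX hn (hw s) hi hlt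
  · by_contra hne
    have hM : n j ≤ mB n S (S j) :=
      Finset.single_le_sum (f := n) (fun h _ => (hn h).le)
        (Finset.mem_filter.2 ⟨Finset.mem_univ j, rfl⟩)
    exact hS.ne_of_lt y n S j hα0 hα1.le hxX hyX hn (hw (S j)) (Ne.symm hne)
      (hlt (S j) hne (hM.trans (hw (S j)))) rfl

end
end
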